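/- For every integer n ≥ 116, the remainder after four terms satisfies −0.0135/n² < R_4(n) < 0.017/n². -/

import Mathlib

open Real Finset Filter Topology

noncomputable def c (m : ℕ) : ℝ :=
  ((-1 : ℝ) ^ m / (4 * Real.sqrt 6) ^ m) *
    ∑ k ∈ Finset.range ((m + 1) / 2 + 1),
      ((m + 1).choose k : ℝ) * ((m + 1 - k : ℕ) : ℝ) / ((m + 1 - 2 * k).factorial : ℝ) *
        (π / 6) ^ ((m : ℤ) - 2 * k)

/-- The number of partitions of `n`, as a real number. -/
noncomputable def p (n : ℕ) : ℝ := (Fintype.card (Nat.Partition n) : ℝ)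

/-- The remainder after `N` terms of the asymptotic expansion. -/
noncomputable def R (N n : ℕ) : ℝ :=
  4 * Real.sqrt 3 * (n : ℝ) * Real.exp (-(π * Real.sqrt (2 * n / 3))) * p n -
    ∑ m ∈ Finset.range N, c m / (n : ℝ) ^ ((m : ℝ) / 2)

section PartitionSeries

open PowerSeries

theorem card_partition_le_two_pow (n : ℕ) : Fintype.card (Nat.Partition n) ≤ 2 ^ (n - 1) := by
  rw [← composition_card]
  exact Fintype.card_le_of_surjective _ Nat.Partition.ofComposition_surj

/-- The number of partitions of `n` all of whose parts exceed `m`. -/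
noncomputable def cardPartitionGt (m n : ℕ) : ℕ := #(Nat.Partition.restricted n (m < ·))

theorem cardPartitionGt_le (m n : ℕ) : cardPartitionGt m n ≤ 2 ^ n :=
  (Finset.card_le_univ _).trans <|
    (card_partition_le_two_pow n).trans (Nat.pow_le_pow_right two_pos (Nat.sub_le n 1))

theorem cardPartitionGt_zero_left (n : ℕ) :
    cardPartitionGt 0 n = Fintype.card (Nat.Partition n) := by
  rw [cardPartitionGt, ← Finset.card_univ]
  congr 1
  ext P
  simpa [Nat.Partition.restricted] using fun i hi => P.parts_pos hi

theorem cardPartitionGt_zero_right (m : ℕ) : cardPartitionGt m 0 = 1 := by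
  rw [cardPartitionGt, Finset.card_eq_one]
  refine ⟨default, ?_⟩
  ext P
  simp [Nat.Partition.restricted, Subsingleton.elim P default]

theorem cardPartitionGt_eq_zero {m n : ℕ} (hn : 0 < n) (h : n ≤ m) : cardPartitionGt m n = 0 := by
  rw [cardPartitionGt, Finset.card_eq_zero, Finset.eq_empty_iff_forall_notMem]
  intro P hP
  simp only [Nat.Partition.restricted, Finset.mem_filter, Finset.mem_univ, true_and] at hP
  have hs := P.parts_sum
  rcases Multiset.empty_or_exists_mem P.parts with h0 | ⟨a, ha⟩
  · rw [h0] at hs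
    simp at hs
    omega
  · have := Multiset.le_sum_of_mem ha
    have := hP a ha
    omega

open scoped PowerSeries.WithPiTopology in
theorem mk_cardPartitionGt_succ (m : ℕ) :
    (PowerSeries.mk fun n => (cardPartitionGt m n : ℤ)) * (1 - X ^ (m + 1)) =
      PowerSeries.mk fun n => (cardPartitionGt (m + 1) n : ℤ) := by
  have h1 := Nat.Partition.hasProd_powerSeriesMk_card_restricted ℤ (m < ·)
  have h2 := Nat.Partition.hasProd_powerSeriesMk_card_restricted ℤ (m + 1 < ·)
  have h3 : HasProd (fun i : ℕ => if i = m then (1 - X ^ (m + 1) : ℤ⟦X⟧) else 1)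
      (1 - X ^ (m + 1)) := hasProd_ite_eq _ _
  refine (h1.mul h3).unique ?_
  convert! h2 using 1
  ext1 i
  rcases lt_trichotomy i m with h | h | h
  · rw [if_neg (by omega), if_neg (by omega), if_neg (by omega), one_mul]
  · subst h
    rw [if_pos (by omega), if_pos rfl, if_neg (by omega)]
    simp_rw [pow_mul]
    exact PowerSeries.WithPiTopology.tsum_pow_mul_one_sub_of_constantCoeff_eq_zero (by simp)
  · rw [if_pos (by omega), if_neg (by omega), if_pos (by omega), mul_one]

open scoped PowerSeries.WithPiTopology in
theorem mk_card_partition_mul_pentagonalSeries :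
    (PowerSeries.mk fun n => (Fintype.card (Nat.Partition n) : ℤ)) * pentagonalSeries ℤ = 1 := by
  have h1 := Nat.Partition.hasProd_powerSeriesMk_card_restricted ℤ (0 < ·)
  have h2 := PowerSeries.WithPiTopology.hasProd_one_sub_X_pow ℤ
  have h3 : (PowerSeries.mk fun n => (Fintype.card (Nat.Partition n) : ℤ)) =
      PowerSeries.mk fun n => (#(Nat.Partition.restricted n (0 < ·)) : ℤ) := by
    ext n
    simp only [coeff_mk, ← cardPartitionGt_zero_left]
    rfl
  rw [h3]
  refine (h1.mul h2).unique ?_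
  convert! (hasProd_one : HasProd (fun _ : ℕ => (1 : ℤ⟦X⟧)) 1) using 1
  ext1 i
  rw [if_pos (by omega)]
  simp_rw [pow_mul]
  exact PowerSeries.WithPiTopology.tsum_pow_mul_one_sub_of_constantCoeff_eq_zero (by simp)

theorem summable_cardPartitionGt (m : ℕ) {q : ℂ} (hq : ‖q‖ < 1 / 2) :
    Summable fun n => (cardPartitionGt m n : ℂ) * q ^ n := by
  have hg : Summable fun n : ℕ => (2 * ‖q‖) ^ n :=
    summable_geometric_of_lt_one (by positivity) (by linarith)
  refine Summable.of_norm_bounded hg fun n => ?_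
  rw [norm_mul, norm_pow, mul_pow, Complex.norm_natCast]
  gcongr
  exact_mod_cast cardPartitionGt_le m n

theorem tsum_cardPartitionGt_succ (m : ℕ) {q : ℂ} (hq : ‖q‖ < 1 / 2) :
    (∑' n, (cardPartitionGt m n : ℂ) * q ^ n) * (1 - q ^ (m + 1)) =
      ∑' n, (cardPartitionGt (m + 1) n : ℂ) * q ^ n := by
  have h0 := summable_cardPartitionGt m hq
  have hshift : HasSum (fun n => if m + 1 ≤ n then
      (cardPartitionGt m (n - (m + 1)) : ℂ) * q ^ n else 0)
      ((∑' n, (cardPartitionGt m n : ℂ) * q ^ n) * q ^ (m + 1)) := by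
    have := h0.hasSum.mul_right (q ^ (m + 1))
    refine (Function.Injective.hasSum_iff (add_left_injective (m + 1)) ?_).1 ?_
    · intro x hx
      rw [if_neg]
      intro h
      exact hx ⟨x - (m + 1), by simp only; omega⟩
    · convert! this using 1
      ext n
      simp [pow_add, mul_assoc, show ¬ n + (m + 1) ≤ m by omega]
  rw [mul_sub, mul_one]
  refine ((h0.hasSum.sub hshift).tsum_eq).symm.trans ?_
  congr 1
  ext n
  have := congrArg (fun F => ((PowerSeries.coeff n F : ℤ) : ℂ)) (mk_cardPartitionGt_succ m)
  simp only [mul_sub, mul_one, map_sub, coeff_mk, PowerSeries.coeff_mul_X_pow', Int.cast_sub,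
    Int.cast_natCast] at this
  rw [← this, sub_mul]
  split_ifs <;> simp

theorem tsum_partition_mul_prod (m : ℕ) {q : ℂ} (hq : ‖q‖ < 1 / 2) :
    (∑' n, (Fintype.card (Nat.Partition n) : ℂ) * q ^ n) * ∏ i ∈ Finset.range m, (1 - q ^ (i + 1)) =
      ∑' n, (cardPartitionGt m n : ℂ) * q ^ n := by
  induction m with
  | zero => simp [cardPartitionGt_zero_left]
  | succ m ih => rw [Finset.prod_range_succ, ← mul_assoc, ih, tsum_cardPartitionGt_succ m hq]

theorem tendsto_tsum_cardPartitionGt {q : ℂ} (hq : ‖q‖ < 1 / 2) :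
    Tendsto (fun m => ∑' n, (cardPartitionGt m n : ℂ) * q ^ n) atTop (𝓝 1) := by
  have hg : Summable fun n : ℕ => (2 * ‖q‖) ^ n :=
    summable_geometric_of_lt_one (by positivity) (by linarith)
  have := tendsto_tsum_of_dominated_convergence (𝓕 := (atTop : Filter ℕ))
    (f := fun m n => (cardPartitionGt m n : ℂ) * q ^ n)
    (g := fun n => if n = 0 then 1 else 0) hg ?_ ?_
  · simpa using this
  · intro n
    refine tendsto_const_nhds.congr' ?_
    filter_upwards [eventually_ge_atTop n] with m hm
    rcases Nat.eq_zero_or_pos n with rfl | hn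
    · simp [cardPartitionGt_zero_right]
    · simp [cardPartitionGt_eq_zero hn hm, hn.ne']
  · refine Eventually.of_forall fun m n => ?_
    rw [norm_mul, norm_pow, mul_pow, Complex.norm_natCast]
    gcongr
    exact_mod_cast cardPartitionGt_le m n

theorem hasSum_card_partition {q : ℂ} (hq : ‖q‖ < 1 / 2) :
    HasSum (fun n => (Fintype.card (Nat.Partition n) : ℂ) * q ^ n)
      (∏' n : ℕ, (1 - q ^ (n + 1)))⁻¹ := by
  have hs := summable_cardPartitionGt 0 hq
  simp only [cardPartitionGt_zero_left] at hs
  have h1 := (ModularForm.multipliable_one_sub_pow (q := q) (by linarith)).hasProd.tendsto_prod_nat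
  have h2 := (h1.const_mul (∑' n, (Fintype.card (Nat.Partition n) : ℂ) * q ^ n))
  simp only [tsum_partition_mul_prod _ hq] at h2
  have h3 := tendsto_nhds_unique h2 (tendsto_tsum_cardPartitionGt hq)
  rw [← eq_inv_of_mul_eq_one_left h3]
  exact hs.hasSum

theorem norm_inv_tprod_sub_one_le {q : ℂ} (hq : ‖q‖ ≤ 1 / 200) :
    ‖(∏' n : ℕ, (1 - q ^ (n + 1)))⁻¹ - 1‖ ≤ 51 / 50 * ‖q‖ := by
  have h := hasSum_card_partition (q := q) (by linarith)
  rw [← hasSum_nat_add_iff' 1] at h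
  have hg : HasSum (fun n : ℕ => ‖q‖ * (2 * ‖q‖) ^ n) (‖q‖ * (1 - 2 * ‖q‖)⁻¹) :=
    (hasSum_geometric_of_lt_one (by positivity) (by linarith)).mul_left _
  have hle : ‖(∏' n : ℕ, (1 - q ^ (n + 1)))⁻¹ - 1‖ ≤ ‖q‖ * (1 - 2 * ‖q‖)⁻¹ := by
    have := h.tsum_eq
    simp only [Finset.range_one, Finset.sum_singleton, pow_zero, mul_one] at this
    rw [show (Fintype.card (Nat.Partition 0) : ℂ) = 1 by simp] at this
    rw [← this]
    refine tsum_of_norm_bounded hg fun n => ?_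
    rw [norm_mul, norm_pow, Complex.norm_natCast, pow_succ, mul_pow]
    have : (Fintype.card (Nat.Partition (n + 1)) : ℝ) ≤ 2 ^ n := by
      exact_mod_cast card_partition_le_two_pow (n + 1)
    calc _ ≤ (2 : ℝ) ^ n * (‖q‖ ^ n * ‖q‖) := by gcongr
      _ = _ := by ring
  refine hle.trans ?_
  rw [mul_comm]
  gcongr
  rw [inv_le_comm₀ (by linarith) (by norm_num), show ((51 : ℝ) / 50)⁻¹ = 50 / 51 by norm_num]
  linarith

end PartitionSeries

section CauchyFormula

/-- The Euler product `∏ (1 - q ^ k)` over `k ≥ 1`. -/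
noncomputable def eulerProd (q : ℂ) : ℂ := ∏' n : ℕ, (1 - q ^ (n + 1))

theorem eulerProd_ne_zero {q : ℂ} (hq : ‖q‖ < 1) : eulerProd q ≠ 0 := by
  refine tprod_one_add_ne_zero_of_summable (f := fun n : ℕ => -q ^ (n + 1)) (fun n => ?_) ?_
  · rw [← sub_eq_add_neg, sub_ne_zero]
    intro h
    have : ‖q‖ ^ (n + 1) < 1 := pow_lt_one₀ (norm_nonneg _) hq (Nat.succ_ne_zero n)
    rw [← norm_pow, ← h] at this
    simp at this
  · simp only [norm_neg, norm_pow]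
    exact (summable_nat_add_iff 1).2 (summable_geometric_of_lt_one (norm_nonneg _) hq)

theorem differentiableOn_eulerProd : DifferentiableOn ℂ eulerProd (Metric.ball 0 1) :=
  ModularForm.differentiableOn_tprod_one_sub_pow

theorem card_partition_eq_integral (n : ℕ) {r : ℝ} (hr : 0 < r) (hr1 : r < 1) :
    (Fintype.card (Nat.Partition n) : ℂ) = (2 * π : ℂ)⁻¹ *
      ∫ θ in (0 : ℝ)..2 * π, (eulerProd (circleMap 0 r θ))⁻¹ * (circleMap 0 r θ ^ n)⁻¹ := by
  lift r to NNReal using hr.le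
  have hd : DifferentiableOn ℂ (fun q => (eulerProd q)⁻¹) (Metric.closedBall 0 r) := by
    have hsub : Metric.closedBall (0 : ℂ) r ⊆ Metric.ball 0 1 := Metric.closedBall_subset_ball hr1
    refine (differentiableOn_eulerProd.mono hsub).inv fun q hq => eulerProd_ne_zero ?_
    simpa using hsub hq
  have h1 := (hd.hasFPowerSeriesOnBall (by exact_mod_cast hr)).hasFPowerSeriesAt
  have h2 : HasFPowerSeriesAt (fun q => (eulerProd q)⁻¹)
      (FormalMultilinearSeries.ofScalars ℂ
        fun n => (Fintype.card (Nat.Partition n) : ℂ)) 0 := by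
    rw [hasFPowerSeriesAt_iff]
    filter_upwards [Metric.ball_mem_nhds (0 : ℂ) (by norm_num : (0 : ℝ) < 1 / 2)] with q hq
    have := hasSum_card_partition (q := q) (by simpa using hq)
    simpa [eulerProd, FormalMultilinearSeries.coeff_ofScalars, mul_comm] using this
  have h3 := congrArg (fun p => p n fun _ => (1 : ℂ)) (h1.eq_formalMultilinearSeries h2)
  simp only [cauchyPowerSeries_apply, FormalMultilinearSeries.ofScalars_apply_eq, one_pow,
    smul_eq_mul, mul_one] at h3
  rw [← h3, circleIntegral, mul_inv _ Complex.I, mul_assoc,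
    ← intervalIntegral.integral_const_mul]
  congr 1
  refine intervalIntegral.integral_congr fun θ _ => ?_
  have : circleMap 0 r θ ≠ 0 := circleMap_ne_center (by exact_mod_cast hr.ne')
  simp only [deriv_circleMap, smul_eq_mul, sub_zero, one_div, inv_pow]
  field_simp

theorem card_partition_eq_integral_exp (n : ℕ) {s₀ : ℝ} (hs : 0 < s₀) :
    (Fintype.card (Nat.Partition n) : ℂ) = (2 * π : ℂ)⁻¹ *
      ∫ θ in -π..π, (eulerProd (Complex.exp (-(s₀ + θ * Complex.I))))⁻¹ *
        Complex.exp (n * (s₀ + θ * Complex.I)) := by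
  have h := card_partition_eq_integral n (Real.exp_pos (-s₀)) (Real.exp_lt_one_iff.2 (by linarith))
  have hper : Function.Periodic (fun θ : ℝ => (eulerProd (circleMap 0 (Real.exp (-s₀)) θ))⁻¹ *
      (circleMap 0 (Real.exp (-s₀)) θ ^ n)⁻¹) (2 * π) := fun θ => by
    simp only [periodic_circleMap 0 _ θ]
  have h2 := hper.intervalIntegral_add_eq 0 (-π)
  rw [zero_add, show -π + 2 * π = π by ring] at h2
  rw [h, h2]
  congr 1
  have h3 := intervalIntegral.integral_comp_neg (a := -π) (b := π)
    (fun θ : ℝ => (eulerProd (circleMap 0 (Real.exp (-s₀)) θ))⁻¹ *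
      (circleMap 0 (Real.exp (-s₀)) θ ^ n)⁻¹)
  rw [neg_neg] at h3
  rw [← h3]
  refine intervalIntegral.integral_congr fun θ _ => ?_
  have : circleMap 0 (Real.exp (-s₀)) (-θ) = Complex.exp (-(s₀ + θ * Complex.I)) := by
    rw [circleMap, zero_add, Complex.ofReal_exp, ← Complex.exp_add]
    congr 1
    push_cast
    ring
  simp only [this]
  rw [← Complex.exp_nat_mul, ← Complex.exp_neg]
  congr 2
  ring

end CauchyFormula

section EtaBounds

open ModularForm UpperHalfPlane
open scoped MatrixGroups

theorem eta_eq_exp_mul_eulerProd (z : ℂ) :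
    eta z = Complex.exp (2 * π * Complex.I * z / 24) *
      eulerProd (Complex.exp (2 * π * Complex.I * z)) := by
  simp [eta, eulerProd, Function.Periodic.qParam, eta_q_eq_pow]

theorem norm_exp_two_pi_I_mul (z : ℂ) :
    ‖Complex.exp (2 * π * Complex.I * z)‖ = Real.exp (-(2 * π * z.im)) := by
  rw [Complex.norm_exp]
  congr 1
  simp

theorem norm_inv_eulerProd_le {q : ℂ} (hq : ‖q‖ ≤ 1 / 200) : ‖(eulerProd q)⁻¹‖ ≤ 101 / 100 := by
  have h := norm_inv_tprod_sub_one_le hq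
  rw [← eulerProd] at h
  have h2 := norm_add_le ((eulerProd q)⁻¹ - 1) 1
  rw [sub_add_cancel, norm_one] at h2
  linarith

theorem exp_neg_two_pi_mul_le {y : ℝ} (hy : 0 < y) (h : 3 ≤ 4 * y ^ 2) :
    Real.exp (-(2 * π * y)) ≤ 1 / 200 := by
  have hy : (0.866 : ℝ) ≤ y := by nlinarith
  have h1 : (5.4 : ℝ) ≤ 2 * π * y := by nlinarith [Real.pi_gt_d2]
  have h2 : (200 : ℝ) ≤ Real.exp 5.4 := by
    rw [show (5.4 : ℝ) = 2 * 2.7 by norm_num, show (2 : ℝ) * 2.7 = 2.7 + 2.7 by norm_num,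
      Real.exp_add]
    have : (14.2 : ℝ) ≤ Real.exp 2.7 := by
      have := Real.sum_le_exp_of_nonneg (x := 2.7) (by norm_num) 10
      norm_num [Finset.sum_range_succ, Nat.factorial] at this ⊢
      linarith
    nlinarith
  rw [Real.exp_neg, one_div]
  gcongr
  exact h2.trans (Real.exp_le_exp.2 h1)

theorem norm_inv_eta_le_of_im {z : ℂ} (hz : 0 < z.im) (h : 3 ≤ 4 * z.im ^ 2) :
    ‖(eta z)⁻¹‖ ≤ 101 / 100 * Real.exp (π * z.im / 12) := by
  have hq := (norm_exp_two_pi_I_mul z).trans_le (exp_neg_two_pi_mul_le hz h)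
  rw [eta_eq_exp_mul_eulerProd, mul_inv, norm_mul, mul_comm]
  refine mul_le_mul (norm_inv_eulerProd_le hq) ?_ (norm_nonneg _) (by norm_num)
  rw [← Complex.exp_neg, Complex.norm_exp]
  apply Real.exp_le_exp.2
  simp
  linarith

theorem norm_inv_eta_smul (γ : SL(2, ℤ)) (τ : ℍ) :
    ‖(eta τ)⁻¹‖ ^ 24 = ‖denom γ τ‖ ^ 12 * ‖(eta (γ • τ : ℍ))⁻¹‖ ^ 24 := by
  have h := congrFun (SlashInvariantForm.slash_action_generators_SL2Z discriminant_S_invariant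
    discriminant_T_invariant γ) τ
  rw [SL_slash_apply] at h
  simp only [discriminant] at h
  have hd := denom_ne_zero γ τ
  rw [norm_inv, norm_inv, inv_pow, inv_pow, ← norm_pow, ← h, norm_mul, mul_inv, zpow_neg,
    norm_inv, inv_inv, norm_zpow, norm_pow, mul_comm]
  norm_cast

theorem norm_inv_eta_le_of_im_lt {τ : ℍ} (hre : |τ.re| ≤ 1 / 2) (h1 : 4 * τ.im ^ 2 < 3)
    (h2 : 4 * (τ.im / Complex.normSq τ) ^ 2 < 3) :
    ‖(eta τ)⁻¹‖ ≤ 101 / 100 * Real.exp (π / (48 * τ.im)) := by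
  obtain ⟨γ, hγ⟩ := ModularGroup.exists_smul_mem_fd τ
  have hY := ModularGroup.three_le_four_mul_im_sq_of_mem_fd hγ
  have hYpos := (γ • τ).im_pos
  have hy := τ.im_pos
  have him := ModularGroup.im_smul_eq_div_normSq γ τ
  have hdpos : 0 < Complex.normSq (denom γ τ) := Complex.normSq_pos.2 (denom_ne_zero γ τ)
  have hyY : τ.im ≤ (γ • τ).im := by nlinarith
  have hd1 : ‖denom γ τ‖ ≤ 1 := by
    have : Complex.normSq (denom γ τ) ≤ 1 := by
      rw [him, le_div_iff₀ hdpos] at hyY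
      nlinarith
    rw [Complex.normSq_eq_norm_sq] at this
    nlinarith [norm_nonneg (denom γ τ)]
  have hle : ‖(eta τ)⁻¹‖ ≤ ‖(eta (γ • τ : ℍ))⁻¹‖ := by
    refine le_of_pow_le_pow_left₀ (n := 24) (by norm_num) (norm_nonneg _) ?_
    rw [norm_inv_eta_smul γ τ]
    exact mul_le_of_le_one_left (by positivity) (pow_le_one₀ (norm_nonneg _) hd1)
  refine hle.trans ((norm_inv_eta_le_of_im hYpos hY).trans ?_)
  have key : (γ • τ).im ≤ 1 / (4 * τ.im) := by
    have hns : Complex.normSq (denom γ τ) =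
        (γ 1 0 * τ.re + γ 1 1) ^ 2 + (γ 1 0 * τ.im) ^ 2 := by
      rw [ModularGroup.denom_apply, Complex.normSq_apply]
      simp
      ring
    rw [him, div_le_div_iff₀ hdpos (by positivity)]
    suffices h : 2 ≤ |γ 1 0| by
      have : (4 : ℝ) ≤ (γ 1 0 : ℝ) ^ 2 := by
        have : (2 : ℝ) ≤ |(γ 1 0 : ℝ)| := by exact_mod_cast h
        rw [← sq_abs]
        nlinarith
      rw [hns]
      nlinarith [sq_nonneg ((γ 1 0 : ℝ) * τ.re + γ 1 1), sq_nonneg τ.im]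
    by_contra hlt
    have hcases : γ 1 0 = 0 ∨ γ 1 0 = 1 ∨ γ 1 0 = -1 := by
      have := abs_lt.1 (not_le.1 hlt)
      omega
    have hxx := abs_le.1 hre
    have hτ : Complex.normSq τ = τ.re ^ 2 + τ.im ^ 2 := by
      rw [Complex.normSq_apply]; simp; ring
    have hτpos : 0 < Complex.normSq τ := by rw [hτ]; positivity
    have hint : ∀ (m : ℤ) (x : ℝ), -(1 / 2) ≤ x → x ≤ 1 / 2 → x ^ 2 ≤ (x + m) ^ 2 := by
      intro m x hx1 hx2
      rcases lt_trichotomy m 0 with hm | hm | hm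
      · have : (m : ℝ) ≤ -1 := by exact_mod_cast (by omega : m ≤ -1)
        nlinarith
      · simp [hm]
      · have : (1 : ℝ) ≤ m := by exact_mod_cast hm
        nlinarith
    have hcontra : Complex.normSq τ ≤ Complex.normSq (denom γ τ) → False := fun hle' => by
      have : (γ • τ).im ≤ τ.im / Complex.normSq τ := by
        rw [him]
        exact div_le_div_of_nonneg_left hy.le hτpos hle'
      nlinarith
    rcases hcases with h | h | h
    · have hdet := γ.det_coe
      rw [Matrix.det_fin_two, h, mul_zero, sub_zero] at hdet
      have : (γ 1 1 : ℝ) ^ 2 = 1 := by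
        have := Int.isUnit_iff.1 (IsUnit.of_mul_eq_one_right _ hdet)
        rcases this with h | h <;> simp [h]
      have him' : (γ • τ).im = τ.im := by
        rw [him, hns, h]
        push_cast
        rw [zero_mul, zero_add, this, zero_mul]
        norm_num
      rw [him'] at hY
      linarith
    · apply hcontra
      rw [hns, hτ, h]
      have := hint (γ 1 1) τ.re hxx.1 hxx.2
      push_cast
      nlinarith
    · apply hcontra
      rw [hns, hτ, h]
      have := hint (-γ 1 1) τ.re hxx.1 hxx.2
      push_cast at this ⊢
      nlinarith
  gcongr 101 / 100 * Real.exp ?_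
  calc π * (γ • τ).im / 12 ≤ π * (1 / (4 * τ.im)) / 12 := by gcongr
    _ = _ := by field_simp; norm_num

theorem log_I_mul {w : ℂ} (hw : 0 < w.re) :
    Complex.log (Complex.I * w) = Complex.log Complex.I + Complex.log w := by
  have hw0 : w ≠ 0 := fun h => by simp [h] at hw
  rw [Complex.log_mul_eq_add_log_iff Complex.I_ne_zero hw0, Complex.arg_I]
  have := abs_lt.1 (Complex.abs_arg_lt_pi_div_two_iff.2 (Or.inl hw))
  constructor <;> linarith [Real.pi_pos]

theorem inv_eta_I_mul {w : ℂ} (hw : 0 < w.re) :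
    (eta (Complex.I * w))⁻¹ =
      Complex.exp (Complex.log w / 2) * (eta (Complex.I / w))⁻¹ := by
  have hw0 : w ≠ 0 := fun h => by simp [h] at hw
  have h := eta_comp_eq_csqrt_I_inv (x := Complex.I * w) (by simpa using hw)
  simp only [Function.comp, Pi.smul_apply, Pi.mul_apply, smul_eq_mul] at h
  rw [sqrt_eq_exp Complex.I_ne_zero, sqrt_eq_exp (mul_ne_zero Complex.I_ne_zero hw0),
    log_I_mul hw, add_div, Complex.exp_add] at h
  have h3 : -1 / (Complex.I * w) = Complex.I / w := by
    field_simp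
    simp
  rw [h3] at h
  rw [h]
  have := Complex.exp_ne_zero (Complex.log w / 2)
  have := Complex.exp_ne_zero (Complex.log Complex.I / 2)
  field_simp

theorem norm_exp_half_log {w : ℂ} (hw : w ≠ 0) : ‖Complex.exp (Complex.log w / 2)‖ ^ 2 = ‖w‖ := by
  rw [← norm_pow, ← Complex.exp_nat_mul]
  push_cast
  rw [mul_div_cancel₀ _ two_ne_zero, Complex.exp_log hw]

/-- Near the positive real axis the transformed `η` is close to its main term, and away from it
both the function and the main term are small. -/
theorem norm_inv_eta_sub_le {w : ℂ} (hw : 0 < w.re) (hw1 : w.re ≤ 1 / 60) (him : |w.im| ≤ 1 / 2) :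
    ‖(eta (Complex.I * w))⁻¹ -
      Complex.exp (Complex.log w / 2) * Complex.exp (π / (12 * w))‖ ≤
      2 * Real.exp (π / (48 * w.re)) := by
  have hw0 : w ≠ 0 := fun h => by simp [h] at hw
  have hns : Complex.normSq w = w.re ^ 2 + w.im ^ 2 := by rw [Complex.normSq_apply]; ring
  have hnpos : 0 < Complex.normSq w := Complex.normSq_pos.2 hw0
  have hnle : Complex.normSq w ≤ 1 := by
    rw [hns]; nlinarith [abs_le.1 him, sq_abs w.im, abs_nonneg w.im]
  have hsq : ‖Complex.exp (Complex.log w / 2)‖ ≤ 1 := by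
    have h1 := norm_exp_half_log hw0
    have h2 : ‖w‖ ≤ 1 := by
      rw [Complex.normSq_eq_norm_sq] at hnle
      nlinarith [norm_nonneg w]
    nlinarith [norm_nonneg (Complex.exp (Complex.log w / 2))]
  set Y : ℝ := w.re / Complex.normSq w with hYdef
  have hY : 0 < Y := by positivity
  have hIw : (Complex.I / w).im = Y := by simp [Complex.div_im, hYdef]
  have hmain : ‖Complex.exp (π / (12 * w))‖ = Real.exp (π * Y / 12) := by
    rw [Complex.norm_exp]
    congr 1
    rw [show (π / (12 * w) : ℂ) = ((π / 12 : ℝ) : ℂ) * w⁻¹ by push_cast; field_simp]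
    rw [Complex.re_ofReal_mul, Complex.inv_re, hYdef]
    ring
  have hbig : (5 / 2 : ℝ) ≤ Real.exp (π / (48 * w.re)) := by
    have : (3 : ℝ) / 2 ≤ π / (48 * w.re) := by
      rw [le_div_iff₀ (by positivity)]
      nlinarith [Real.pi_gt_three]
    linarith [Real.add_one_le_exp (π / (48 * w.re))]
  by_cases hY3 : 3 ≤ 4 * Y ^ 2
  · rw [inv_eta_I_mul hw, eta_eq_exp_mul_eulerProd, mul_inv, ← Complex.exp_neg, ← mul_sub]
    have harg : -(2 * π * Complex.I * (Complex.I / w) / 24) = (π / (12 * w) : ℂ) := by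
      field_simp
      simp
      ring
    have hq := norm_exp_two_pi_I_mul (Complex.I / w)
    rw [hIw] at hq
    have hq2 := exp_neg_two_pi_mul_le hY hY3
    have hE := norm_inv_tprod_sub_one_le (hq.trans_le hq2)
    rw [← eulerProd, hq] at hE
    rw [harg, ← mul_sub_one, norm_mul, norm_mul, hmain]
    calc _ ≤ 1 * (Real.exp (π * Y / 12) * (51 / 50 * Real.exp (-(2 * π * Y)))) := by gcongr
      _ = 51 / 50 * Real.exp (π * Y / 12 + -(2 * π * Y)) := by rw [Real.exp_add]; ring
      _ ≤ 51 / 50 * 1 := by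
        gcongr
        rw [Real.exp_le_one_iff]
        nlinarith [mul_pos Real.pi_pos hY]
      _ ≤ _ := by linarith
  · rw [not_le] at hY3
    have h1 := norm_inv_eta_le_of_im_lt (τ := ⟨Complex.I * w, by simpa using hw⟩)
      (by simpa [UpperHalfPlane.re] using him)
      (by simp [UpperHalfPlane.im]; nlinarith)
      (by simpa [UpperHalfPlane.im] using hY3)
    simp only [UpperHalfPlane.im, Complex.mul_im, Complex.I_re, zero_mul,
      Complex.I_im, one_mul, zero_add] at h1
    have h2 : Real.exp (π * Y / 12) ≤ 3 / 2 := by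
      have hY1 : Y ≤ 0.867 := by nlinarith
      have : π * Y / 12 ≤ 1 / 4 := by nlinarith [Real.pi_lt_d2, Real.pi_pos]
      refine (Real.exp_le_exp.2 this).trans ?_
      have := Real.exp_bound_div_one_sub_of_interval (x := 1 / 4) (by norm_num) (by norm_num)
      linarith
    refine (norm_sub_le _ _).trans ?_
    rw [norm_mul, hmain]
    have : ‖Complex.exp (Complex.log w / 2)‖ * Real.exp (π * Y / 12) ≤ 1 * (3 / 2) := by gcongr
    linarith

end EtaBounds

section CircleMethod

open ModularForm

theorem card_partition_eq_integral_eta (n : ℕ) {σ : ℝ} (hσ : 0 < σ) :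
    (Fintype.card (Nat.Partition n) : ℂ) =
      ∫ t in (-(1 / 2) : ℝ)..1 / 2, (eta (Complex.I * (σ + t * Complex.I)))⁻¹ *
        Complex.exp (2 * π * (n - 1 / 24) * (σ + t * Complex.I)) := by
  have hpi := Real.pi_pos
  have h := card_partition_eq_integral_exp n (s₀ := 2 * π * σ) (by positivity)
  have hsub := intervalIntegral.smul_integral_comp_mul_left (a := (-(1 / 2) : ℝ)) (b := 1 / 2)
    (f := fun θ : ℝ => (eulerProd (Complex.exp (-((2 * π * σ : ℝ) + θ * Complex.I))))⁻¹ *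
        Complex.exp (n * ((2 * π * σ : ℝ) + θ * Complex.I))) (2 * π)
  rw [Complex.real_smul, show 2 * π * -(1 / 2) = -π by ring,
    show 2 * π * (1 / 2) = π by ring] at hsub
  rw [h, ← hsub]
  push_cast
  rw [inv_mul_cancel_left₀ (by exact_mod_cast (by positivity : 2 * π ≠ 0))]
  refine intervalIntegral.integral_congr fun t _ => ?_
  have h1 : (2 * π * σ + 2 * π * t * Complex.I : ℂ) = 2 * π * (σ + t * Complex.I) := by ring
  have h2 : (2 * π * Complex.I * (Complex.I * (σ + t * Complex.I)) : ℂ) =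
      -(2 * π * (σ + t * Complex.I)) := by
    linear_combination (2 * π * (σ + t * Complex.I)) * Complex.I_sq
  simp only [h1, eta_eq_exp_mul_eulerProd, h2]
  have hfac : Complex.exp (n * (2 * π * (σ + t * Complex.I))) =
      Complex.exp (-(-(2 * π * (σ + t * Complex.I)) / 24)) *
        Complex.exp (2 * π * (n - 1 / 24) * (σ + t * Complex.I)) := by
    rw [← Complex.exp_add]
    congr 1
    ring
  rw [mul_inv, ← Complex.exp_neg, hfac]
  ring

theorem continuous_eta_vertical {σ : ℝ} (hσ : 0 < σ) :
    Continuous fun t : ℝ => (eta (Complex.I * (σ + t * Complex.I)))⁻¹ := by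
  have hmem : ∀ t : ℝ, 0 < (Complex.I * (σ + t * Complex.I)).im := fun t => by simpa using hσ
  refine continuous_iff_continuousAt.2 fun t => ContinuousAt.inv₀ ?_ (eta_ne_zero (hmem t))
  refine ContinuousAt.comp (f := fun t : ℝ => Complex.I * (σ + t * Complex.I)) (g := eta)
    (differentiableAt_eta_of_mem_upperHalfPlaneSet (hmem t)).continuousAt ?_
  fun_prop

/-- The main part of the integrand in the circle method. -/
noncomputable def mainIntegrand (A B : ℝ) (w : ℂ) : ℂ :=
  Complex.exp (Complex.log w / 2) * Complex.exp (A * w + B / w)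

theorem continuous_mainIntegrand_vertical (A B : ℝ) {σ : ℝ} (hσ : 0 < σ) :
    Continuous fun t : ℝ => mainIntegrand A B (σ + t * Complex.I) := by
  unfold mainIntegrand
  have hre : ∀ t : ℝ, 0 < ((σ : ℂ) + t * Complex.I).re := fun t => by simpa using hσ
  have hlog : Continuous fun t : ℝ => Complex.log (σ + t * Complex.I) :=
    Continuous.clog (by fun_prop) fun t => Or.inl (hre t)
  have hdiv : Continuous fun t : ℝ => (B : ℂ) / (σ + t * Complex.I) :=
    Continuous.div (by fun_prop) (by fun_prop) fun t h => by
      have := hre t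
      rw [h] at this
      simp at this
  fun_prop

theorem norm_card_partition_sub_integral_le (n : ℕ) {σ : ℝ} (hσ : 0 < σ) (hσ1 : σ ≤ 1 / 60) :
    ‖(Fintype.card (Nat.Partition n) : ℂ) - ∫ t in (-(1 / 2) : ℝ)..1 / 2,
      mainIntegrand (2 * π * (n - 1 / 24)) (π / 12) (σ + t * Complex.I)‖ ≤
      2 * Real.exp (π / (48 * σ) + 2 * π * (n - 1 / 24) * σ) := by
  have hc : Continuous fun t : ℝ => (eta (Complex.I * (σ + t * Complex.I)))⁻¹ *
      Complex.exp (2 * π * (n - 1 / 24) * (σ + t * Complex.I)) :=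
    (continuous_eta_vertical hσ).mul (by fun_prop)
  rw [card_partition_eq_integral_eta n hσ, ← intervalIntegral.integral_sub
    (hc.intervalIntegrable _ _)
    ((continuous_mainIntegrand_vertical _ _ hσ).intervalIntegrable _ _)]
  refine (intervalIntegral.norm_integral_le_of_norm_le_const
    (C := 2 * Real.exp (π / (48 * σ) + 2 * π * (n - 1 / 24) * σ)) fun t ht => ?_).trans
    (by norm_num)
  rw [Set.uIoc_of_le (by norm_num)] at ht
  set w : ℂ := σ + t * Complex.I with hw
  have hre : w.re = σ := by simp [hw]
  have him : w.im = t := by simp [hw]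
  have hbound := norm_inv_eta_sub_le (w := w) (by rw [hre]; exact hσ) (by rw [hre]; exact hσ1)
    (by rw [him]; exact abs_le.2 ⟨ht.1.le, ht.2⟩)
  rw [hre] at hbound
  have hfac : (eta (Complex.I * w))⁻¹ * Complex.exp (2 * π * (n - 1 / 24) * w) -
      mainIntegrand (2 * π * (n - 1 / 24)) (π / 12) w =
      ((eta (Complex.I * w))⁻¹ - Complex.exp (Complex.log w / 2) * Complex.exp (π / (12 * w))) *
        Complex.exp (2 * π * (n - 1 / 24) * w) := by
    rw [mainIntegrand, Complex.exp_add]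
    push_cast
    rw [show (π / 12 / w : ℂ) = π / (12 * w) by rw [div_div]]
    ring
  rw [hfac, norm_mul, Real.exp_add, ← mul_assoc]
  refine mul_le_mul hbound (le_of_eq ?_) (norm_nonneg _) (by positivity)
  rw [Complex.norm_exp]
  congr 1
  rw [show (2 * π * (n - 1 / 24) * w : ℂ) = ((2 * π * (n - 1 / 24) : ℝ) : ℂ) * w by push_cast; ring,
    Complex.re_ofReal_mul, hre]

end CircleMethod

section GaussianPrimitive

theorem abs_integral_exp_neg_sq_sub_le {β : ℝ} (hβ : 0 ≤ β) :
    |(∫ y in (0 : ℝ)..β, Real.exp (-y ^ 2)) - √π / 2| ≤ Real.exp (-β ^ 2) := by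
  have hc : Continuous fun y : ℝ => Real.exp (-y ^ 2) := by fun_prop
  have hint : ∀ a b : ℝ, IntervalIntegrable (fun y : ℝ => Real.exp (-y ^ 2))
    MeasureTheory.volume a b := fun a b => hc.intervalIntegrable a b
  have hgauss : ∫ y in Set.Ioi (0 : ℝ), Real.exp (-y ^ 2) = √π / 2 := by
    simpa using integral_gaussian_Ioi 1
  have hgi : MeasureTheory.Integrable fun y : ℝ => Real.exp (-y ^ 2) := by
    simpa using integrable_exp_neg_mul_sq one_pos
  have hlim := MeasureTheory.intervalIntegral_tendsto_integral_Ioi 0 hgi.integrableOn tendsto_id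
  rw [hgauss] at hlim
  have hlim2 := MeasureTheory.intervalIntegral_tendsto_integral_Ioi 0 hgi.integrableOn
    (tendsto_atTop_add_const_right atTop β tendsto_id)
  rw [hgauss] at hlim2
  have hsplit : ∀ T : ℝ, (∫ y in (0 : ℝ)..T + β, Real.exp (-y ^ 2)) =
      (∫ y in (0 : ℝ)..β, Real.exp (-y ^ 2)) + ∫ y in (0 : ℝ)..T, Real.exp (-(y + β) ^ 2) := by
    intro T
    rw [intervalIntegral.integral_comp_add_right (fun y => Real.exp (-y ^ 2)), zero_add,
      intervalIntegral.integral_add_adjacent_intervals (hint _ _) (hint _ _)]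
  have hupper : ∀ T : ℝ, 0 ≤ T → (∫ y in (0 : ℝ)..T, Real.exp (-(y + β) ^ 2)) ≤
      Real.exp (-β ^ 2) * ∫ y in (0 : ℝ)..T, Real.exp (-y ^ 2) := by
    intro T hT
    rw [← intervalIntegral.integral_const_mul]
    refine intervalIntegral.integral_mono_on hT (Continuous.intervalIntegrable (by fun_prop) _ _)
      (Continuous.intervalIntegrable (by fun_prop) _ _) fun y hy => ?_
    rw [← Real.exp_add]
    apply Real.exp_le_exp.2
    nlinarith [mul_nonneg hy.1 hβ]
  have h1 : (∫ y in (0 : ℝ)..β, Real.exp (-y ^ 2)) ≤ √π / 2 := by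
    refine ge_of_tendsto hlim2 ?_
    filter_upwards [eventually_ge_atTop 0] with T hT
    simp only [id]
    rw [hsplit T]
    have := intervalIntegral.integral_nonneg (μ := MeasureTheory.volume) hT
      (fun y _ => (Real.exp_pos (-(y + β) ^ 2)).le)
    linarith
  have h2 : √π / 2 ≤ (∫ y in (0 : ℝ)..β, Real.exp (-y ^ 2)) + Real.exp (-β ^ 2) * (√π / 2) := by
    refine le_of_tendsto_of_tendsto hlim2 ((hlim.const_mul _).const_add _) ?_
    filter_upwards [eventually_ge_atTop 0] with T hT
    simp only [id]
    rw [hsplit T]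
    linarith [hupper T hT]
  have h3 : √π / 2 ≤ 1 := by
    have : √π ≤ 2 := Real.sqrt_le_iff.2 ⟨by norm_num, by linarith [Real.pi_le_four]⟩
    linarith
  rw [abs_le]
  constructor <;> nlinarith [Real.exp_pos (-β ^ 2)]

theorem exists_primitive_exp_sq :
    ∃ Φ : ℂ → ℂ, Φ 0 = 0 ∧ ∀ u, HasDerivAt Φ (Complex.exp (u ^ 2)) u := by
  have hd : Differentiable ℂ fun u : ℂ => Complex.exp (u ^ 2) := by fun_prop
  obtain ⟨Φ, h0, h⟩ := hd.isExactOn_univ.with_val_at 0 0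
  exact ⟨Φ, by simpa using h0, fun u => h u (Set.mem_univ u)⟩

/-- The entire primitive of `exp (u ^ 2)` vanishing at `0`. -/
noncomputable def expSqPrimitive : ℂ → ℂ := exists_primitive_exp_sq.choose

theorem expSqPrimitive_zero : expSqPrimitive 0 = 0 := exists_primitive_exp_sq.choose_spec.1

theorem hasDerivAt_expSqPrimitive (u : ℂ) :
    HasDerivAt expSqPrimitive (Complex.exp (u ^ 2)) u := exists_primitive_exp_sq.choose_spec.2 u

theorem expSqPrimitive_neg (u : ℂ) : expSqPrimitive (-u) = -expSqPrimitive u := by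
  have hd : ∀ v, HasDerivAt (fun v => expSqPrimitive (-v) + expSqPrimitive v) 0 v := fun v => by
    have := ((hasDerivAt_expSqPrimitive (-v)).comp v (hasDerivAt_neg v)).add
      (hasDerivAt_expSqPrimitive v)
    simp only [even_two, Even.neg_pow, mul_neg, mul_one, neg_add_cancel] at this
    exact this
  have := is_const_of_deriv_eq_zero (fun v => (hd v).differentiableAt) (fun v => (hd v).deriv) u 0
  simp only [neg_zero, expSqPrimitive_zero, add_zero] at this
  exact eq_neg_of_add_eq_zero_left this

theorem expSqPrimitive_mul_I (β : ℝ) :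
    expSqPrimitive (β * Complex.I) =
      Complex.I * ((∫ y in (0 : ℝ)..β, Real.exp (-y ^ 2) : ℝ) : ℂ) := by
  have hd : ∀ y : ℝ, HasDerivAt (fun y : ℝ => expSqPrimitive (y * Complex.I))
      (Complex.I * (Real.exp (-y ^ 2) : ℝ)) y := fun y => by
    have h1 : HasDerivAt (fun y : ℂ => y * Complex.I) Complex.I (y : ℂ) := by
      simpa using (hasDerivAt_id (y : ℂ)).mul_const Complex.I
    have := ((hasDerivAt_expSqPrimitive (y * Complex.I)).comp (y : ℂ) h1).comp_ofReal
    convert! this using 1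
    rw [mul_pow, Complex.I_sq, mul_comm]
    push_cast
    ring_nf
  have := intervalIntegral.integral_eq_sub_of_hasDerivAt (a := 0) (b := β) (fun y _ => hd y)
    (Continuous.intervalIntegrable (by fun_prop) _ _)
  simp only [Complex.ofReal_zero, zero_mul, expSqPrimitive_zero, sub_zero] at this
  rw [← this, intervalIntegral.integral_const_mul, intervalIntegral.integral_ofReal]

theorem norm_expSqPrimitive_sub_le {u : ℂ} (hu : 0 ≤ u.im) :
    ‖expSqPrimitive u - Complex.I * (√π / 2 : ℝ)‖ ≤ (‖u‖ + 1) * Real.exp (u ^ 2).re := by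
  have hre : (u ^ 2).re = u.re ^ 2 - u.im ^ 2 := by rw [pow_two, Complex.mul_re]; ring
  have h1 : ‖expSqPrimitive (u.im * Complex.I) - Complex.I * (√π / 2 : ℝ)‖ ≤
      Real.exp (u ^ 2).re := by
    rw [expSqPrimitive_mul_I, ← mul_sub, norm_mul, Complex.norm_I, one_mul, ← Complex.ofReal_sub,
      Complex.norm_real]
    refine (abs_integral_exp_neg_sq_sub_le hu).trans (Real.exp_le_exp.2 ?_)
    nlinarith [sq_nonneg u.re]
  have h2 : ‖expSqPrimitive u - expSqPrimitive (u.im * Complex.I)‖ ≤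
      Real.exp (u ^ 2).re * ‖u - u.im * Complex.I‖ := by
    refine Convex.norm_image_sub_le_of_norm_hasDerivWithin_le
      (f' := fun v => Complex.exp (v ^ 2)) (s := segment ℝ (u.im * Complex.I) u)
      (fun v _ => (hasDerivAt_expSqPrimitive v).hasDerivWithinAt) (fun v hv => ?_)
      (convex_segment _ _) (left_mem_segment _ _ _) (right_mem_segment _ _ _)
    obtain ⟨a, b, ha, hb, hab, rfl⟩ := hv
    rw [Complex.norm_exp]
    apply Real.exp_le_exp.2
    rw [hre, pow_two, Complex.mul_re]
    simp
    have h3 : a * u.im + b * u.im = u.im := by rw [← add_mul, hab, one_mul]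
    rw [h3]
    have hb1 : b ≤ 1 := by linarith
    nlinarith [mul_nonneg (sub_nonneg.2 (show b ^ 2 ≤ 1 by nlinarith)) (sq_nonneg u.re)]
  have h3 : ‖u - u.im * Complex.I‖ ≤ ‖u‖ := by
    have : u - u.im * Complex.I = u.re := by
      nth_rewrite 1 [← Complex.re_add_im u]
      ring
    rw [this, Complex.norm_real]
    exact Complex.abs_re_le_norm u
  have h4 := norm_add_le (expSqPrimitive u - expSqPrimitive (u.im * Complex.I))
    (expSqPrimitive (u.im * Complex.I) - Complex.I * (√π / 2 : ℝ))
  rw [sub_add_sub_cancel] at h4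
  nlinarith [mul_le_mul_of_nonneg_left h3 (Real.exp_pos (u ^ 2).re).le]

end GaussianPrimitive

section MainIntegral

theorem exp_half_log_sq {w : ℂ} (hw : w ≠ 0) : Complex.exp (Complex.log w / 2) ^ 2 = w := by
  rw [← Complex.exp_nat_mul]
  push_cast
  rw [mul_div_cancel₀ _ two_ne_zero, Complex.exp_log hw]

theorem hasDerivAt_exp_half_log {w : ℂ} (hw : w ∈ Complex.slitPlane) :
    HasDerivAt (fun w => Complex.exp (Complex.log w / 2))
      (1 / (2 * Complex.exp (Complex.log w / 2))) w := by
  have hw0 := Complex.slitPlane_ne_zero hw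
  have h := ((Complex.hasDerivAt_log hw).div_const 2).cexp
  convert! h using 1
  nth_rewrite 3 [← exp_half_log_sq hw0]
  have := Complex.exp_ne_zero (Complex.log w / 2)
  field_simp

theorem exp_half_log_im_nonneg {w : ℂ} (hw : 0 ≤ w.im) :
    0 ≤ (Complex.exp (Complex.log w / 2)).im := by
  rw [Complex.exp_im]
  refine mul_nonneg (Real.exp_pos _).le ?_
  have h : (Complex.log w / 2).im = w.arg / 2 := by
    rw [show Complex.log w / 2 = ((1 / 2 : ℝ) : ℂ) * Complex.log w by push_cast; ring,
      Complex.im_ofReal_mul, Complex.log_im]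
    ring
  rw [h]
  have := Complex.arg_nonneg_iff.2 hw
  exact Real.sin_nonneg_of_nonneg_of_le_pi (by linarith) (by linarith [Complex.arg_le_pi w])

theorem exp_half_log_im_nonpos {w : ℂ} (hw : w.im < 0) :
    (Complex.exp (Complex.log w / 2)).im ≤ 0 := by
  rw [Complex.exp_im]
  refine mul_nonpos_of_nonneg_of_nonpos (Real.exp_pos _).le ?_
  have h : (Complex.log w / 2).im = w.arg / 2 := by
    rw [show Complex.log w / 2 = ((1 / 2 : ℝ) : ℂ) * Complex.log w by push_cast; ring,
      Complex.im_ofReal_mul, Complex.log_im]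
    ring
  rw [h]
  have := Complex.arg_neg_iff.2 hw
  exact Real.sin_nonpos_of_nonpos_of_neg_pi_le (by linarith)
    (by linarith [Complex.neg_pi_lt_arg w, Real.pi_pos])

/-- The building block `exp (-2ab) Φ(a √w + b / √w)` of the primitive of the main integrand. -/
noncomputable def primitiveTerm (a b : ℝ) (w : ℂ) : ℂ :=
  Complex.exp (-(2 * a * b)) * expSqPrimitive
    (a * Complex.exp (Complex.log w / 2) + b / Complex.exp (Complex.log w / 2))

theorem primitiveTerm_arg_sq (a b : ℝ) {w : ℂ} (hw : w ≠ 0) :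
    (a * Complex.exp (Complex.log w / 2) + b / Complex.exp (Complex.log w / 2)) ^ 2 =
      2 * a * b + (a ^ 2 * w + b ^ 2 / w) := by
  nth_rewrite 3 4 [← exp_half_log_sq hw]
  have := Complex.exp_ne_zero (Complex.log w / 2)
  field_simp
  ring

theorem hasDerivAt_primitiveTerm (a b : ℝ) {w : ℂ} (hw : w ∈ Complex.slitPlane) :
    HasDerivAt (primitiveTerm a b)
      (Complex.exp (a ^ 2 * w + b ^ 2 / w) * (a / (2 * Complex.exp (Complex.log w / 2)) -
        b / (2 * Complex.exp (Complex.log w / 2) ^ 3))) w := by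
  have hw0 := Complex.slitPlane_ne_zero hw
  have hs := hasDerivAt_exp_half_log hw
  have hne := Complex.exp_ne_zero (Complex.log w / 2)
  have hu := (hs.const_mul (a : ℂ)).add ((hasDerivAt_const w (b : ℂ)).div hs hne)
  have h := ((hasDerivAt_expSqPrimitive _).comp w hu).const_mul (Complex.exp (-(2 * a * b)))
  convert! h using 1
  simp only [Pi.add_apply, Pi.div_apply]
  rw [primitiveTerm_arg_sq a b hw0, ← mul_assoc, ← Complex.exp_add, neg_add_cancel_left]
  congr 1
  field_simp
  ring

theorem norm_primitiveTerm_sub_le {a b : ℝ} (hab : 2 * |b| ≤ a) {w : ℂ} (h1 : 1 / 2 ≤ ‖w‖)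
    (h2 : ‖w‖ ≤ 1) (ε : ℝ) (hε : ε = 1 ∧ 0 ≤ w.im ∨ ε = -1 ∧ w.im < 0) :
    ‖primitiveTerm a b w - Complex.exp (-(2 * a * b)) * (ε * (Complex.I * (√π / 2 : ℝ)))‖ ≤
      (a + 3 / 2 * |b| + 1) * Real.exp (a ^ 2 * w + b ^ 2 / w : ℂ).re := by
  have hw0 : w ≠ 0 := norm_pos_iff.1 (by linarith)
  have ha : 0 ≤ a := (by positivity : 0 ≤ 2 * |b|).trans hab
  set v := Complex.exp (Complex.log w / 2) with hv
  have hvne : v ≠ 0 := Complex.exp_ne_zero _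
  have hvsq : ‖v‖ ^ 2 = ‖w‖ := norm_exp_half_log hw0
  have hv1 : ‖v‖ ≤ 1 := by nlinarith [norm_nonneg v]
  have hv2 : 2 / 3 ≤ ‖v‖ := by nlinarith [norm_nonneg v]
  set u : ℂ := a * v + b / v with hu
  have hunorm : ‖u‖ ≤ a + 3 / 2 * |b| := by
    refine (norm_add_le _ _).trans ?_
    rw [norm_mul, norm_div, Complex.norm_real, Complex.norm_real, Real.norm_eq_abs,
      Real.norm_eq_abs, abs_of_nonneg ha]
    have h3 : |b| / ‖v‖ ≤ 3 / 2 * |b| := by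
      rw [div_le_iff₀ (by linarith)]
      nlinarith [abs_nonneg b]
    nlinarith
  have huim : u.im = (a - b / ‖w‖) * v.im := by
    rw [hu, Complex.add_im, Complex.im_ofReal_mul, div_eq_mul_inv, Complex.im_ofReal_mul,
      Complex.inv_im, Complex.normSq_eq_norm_sq, hvsq]
    ring
  have hcoef : 0 ≤ a - b / ‖w‖ := by
    have : b / ‖w‖ ≤ 2 * |b| := by
      rw [div_le_iff₀ (by linarith)]
      nlinarith [abs_nonneg b, le_abs_self b]
    linarith
  have hsq : (u ^ 2).re = 2 * a * b + (a ^ 2 * w + b ^ 2 / w : ℂ).re := by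
    rw [hu, primitiveTerm_arg_sq a b hw0, Complex.add_re]
    congr 1
    rw [show (2 * a * b : ℂ) = ((2 * a * b : ℝ) : ℂ) by push_cast; rfl, Complex.ofReal_re]
  have key : ‖expSqPrimitive u - ε * (Complex.I * (√π / 2 : ℝ))‖ ≤
      (‖u‖ + 1) * Real.exp (u ^ 2).re := by
    rcases hε with ⟨rfl, him⟩ | ⟨rfl, him⟩
    · rw [Complex.ofReal_one, one_mul]
      apply norm_expSqPrimitive_sub_le
      rw [huim]
      exact mul_nonneg hcoef (exp_half_log_im_nonneg him)
    · have := norm_expSqPrimitive_sub_le (u := -u) (by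
        rw [Complex.neg_im, huim, neg_nonneg]
        exact mul_nonpos_of_nonneg_of_nonpos hcoef (exp_half_log_im_nonpos him))
      rw [expSqPrimitive_neg, neg_sq, norm_neg, ← norm_neg] at this
      convert! this using 2
      push_cast
      ring
  have hnorm : ‖Complex.exp (-(2 * a * b))‖ = Real.exp (-(2 * a * b)) := by
    rw [Complex.norm_exp]
    congr 1
    rw [show (-(2 * a * b) : ℂ) = ((-(2 * a * b) : ℝ) : ℂ) by push_cast; rfl, Complex.ofReal_re]
  rw [primitiveTerm, ← mul_sub, norm_mul, hnorm]
  calc Real.exp (-(2 * a * b)) * ‖expSqPrimitive u - ε * (Complex.I * (√π / 2 : ℝ))‖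
      ≤ Real.exp (-(2 * a * b)) * ((a + 3 / 2 * |b| + 1) * Real.exp (u ^ 2).re) := by
        refine mul_le_mul_of_nonneg_left (key.trans ?_) (Real.exp_pos _).le
        gcongr
    _ = (a + 3 / 2 * |b| + 1) * (Real.exp (-(2 * a * b)) * Real.exp (u ^ 2).re) := by ring
    _ = _ := by rw [hsq, ← Real.exp_add, neg_add_cancel_left]

/-- A primitive of `mainIntegrand (a ^ 2) (b ^ 2)` on the slit plane. -/
noncomputable def mainPrimitive (a b : ℝ) (w : ℂ) : ℂ :=
  1 / a ^ 2 * (Complex.exp (Complex.log w / 2) * Complex.exp (a ^ 2 * w + b ^ 2 / w) -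
    1 / (2 * a) * (primitiveTerm a b w + primitiveTerm a (-b) w) +
    b * (primitiveTerm a (-b) w - primitiveTerm a b w))

theorem hasDerivAt_mainPrimitive {a : ℝ} (ha : a ≠ 0) (b : ℝ) {w : ℂ}
    (hw : w ∈ Complex.slitPlane) :
    HasDerivAt (mainPrimitive a b) (mainIntegrand (a ^ 2) (b ^ 2) w) w := by
  have hw0 := Complex.slitPlane_ne_zero hw
  have hs := hasDerivAt_exp_half_log hw
  have h1 := hasDerivAt_primitiveTerm a b hw
  have h2 := hasDerivAt_primitiveTerm a (-b) hw
  have hE : HasDerivAt (fun w : ℂ => Complex.exp (a ^ 2 * w + b ^ 2 / w))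
      (Complex.exp (a ^ 2 * w + b ^ 2 / w) * (a ^ 2 - b ^ 2 / w ^ 2)) w := by
    have := (((hasDerivAt_id w).const_mul ((a : ℂ) ^ 2)).add
      ((hasDerivAt_const w ((b : ℂ) ^ 2)).div (hasDerivAt_id w) hw0)).cexp
    convert! this using 1
    simp
    ring
  have h := (((hs.mul hE).sub ((h1.add h2).const_mul (1 / (2 * a : ℂ)))).add
    ((h2.sub h1).const_mul (b : ℂ))).const_mul (1 / (a : ℂ) ^ 2)
  convert! h using 1
  have haC : (a : ℂ) ≠ 0 := by exact_mod_cast ha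
  have hne := Complex.exp_ne_zero (Complex.log w / 2)
  rw [mainIntegrand]
  push_cast
  rw [neg_sq]
  set E := Complex.exp (a ^ 2 * w + b ^ 2 / w)
  have hv := exp_half_log_sq hw0
  set v := Complex.exp (Complex.log w / 2)
  rw [← hv]
  field_simp
  ring

theorem integral_mainIntegrand_eq {a : ℝ} (ha : a ≠ 0) (b : ℝ) {σ : ℝ} (hσ : 0 < σ) :
    ∫ t in (-(1 / 2) : ℝ)..1 / 2, mainIntegrand (a ^ 2) (b ^ 2) (σ + t * Complex.I) =
      -Complex.I * (mainPrimitive a b (σ + (1 / 2 : ℝ) * Complex.I) -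
        mainPrimitive a b (σ + (-(1 / 2) : ℝ) * Complex.I)) := by
  have hd : ∀ t : ℝ, HasDerivAt
      (fun t : ℝ => -Complex.I * mainPrimitive a b (σ + t * Complex.I))
      (mainIntegrand (a ^ 2) (b ^ 2) (σ + t * Complex.I)) t := fun t => by
    have h1 : HasDerivAt (fun t : ℂ => σ + t * Complex.I) Complex.I (t : ℂ) := by
      simpa using ((hasDerivAt_id (t : ℂ)).mul_const Complex.I).const_add (σ : ℂ)
    have hmem : (σ + t * Complex.I : ℂ) ∈ Complex.slitPlane := Or.inl (by simpa using hσ)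
    have := (((hasDerivAt_mainPrimitive ha b hmem).comp (t : ℂ) h1).const_mul
      (-Complex.I)).comp_ofReal
    convert! this using 1
    linear_combination (mainIntegrand (a ^ 2) (b ^ 2) (σ + t * Complex.I)) * Complex.I_sq
  have h := intervalIntegral.integral_eq_sub_of_hasDerivAt (a := -(1 / 2)) (b := 1 / 2)
    (fun t _ => hd t) ((by
      simpa using continuous_mainIntegrand_vertical (a ^ 2) (b ^ 2) hσ :
        Continuous fun t : ℝ => mainIntegrand (a ^ 2) (b ^ 2)
          (σ + t * Complex.I)).intervalIntegrable _ _)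
  rw [h, mul_sub]

theorem norm_mainPrimitive_sub_le {a b : ℝ} (ha : 50 ≤ a) (hb : 0 ≤ b) (hb1 : b ≤ 13 / 25) {w : ℂ}
    (h1 : 1 / 2 ≤ ‖w‖) (h2 : ‖w‖ ≤ 1) (ε : ℝ)
    (hε : ε = 1 ∧ 0 ≤ w.im ∨ ε = -1 ∧ w.im < 0) :
    ‖mainPrimitive a b w - ε * (Complex.I * (√π / 2 * (1 / a ^ 2 *
      (b * (Real.exp (2 * a * b) - Real.exp (-(2 * a * b))) -
        1 / (2 * a) * (Real.exp (2 * a * b) + Real.exp (-(2 * a * b))))) : ℝ))‖ ≤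
      1 / 20 * Real.exp (a ^ 2 * w + b ^ 2 / w : ℂ).re := by
  have hab : 2 * |b| ≤ a := by rw [abs_of_nonneg hb]; linarith
  have e1 := norm_primitiveTerm_sub_le hab h1 h2 ε hε
  have e2 := norm_primitiveTerm_sub_le (a := a) (b := -b) (by rwa [abs_neg]) h1 h2 ε hε
  have hw0 : w ≠ 0 := norm_pos_iff.1 (by linarith)
  have hv : ‖Complex.exp (Complex.log w / 2)‖ ≤ 1 := by
    have := norm_exp_half_log hw0
    nlinarith [norm_nonneg (Complex.exp (Complex.log w / 2))]
  rw [abs_neg] at e2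
  rw [abs_of_nonneg hb] at e1 e2
  push_cast at e2
  rw [neg_sq, mul_neg, neg_neg] at e2
  set r := (a ^ 2 * w + b ^ 2 / w : ℂ).re with hr
  set P := primitiveTerm a b w
  set Q := primitiveTerm a (-b) w
  set v := Complex.exp (Complex.log w / 2)
  set L : ℂ := ε * (Complex.I * (√π / 2 : ℝ)) with hL
  set X := P - Complex.exp (-(2 * a * b)) * L with hX
  have e2' : ‖Q - Complex.exp (2 * a * b) * L‖ ≤ (a + 3 / 2 * b + 1) * Real.exp r := by
    simpa [hL] using e2
  have e1' : ‖X‖ ≤ (a + 3 / 2 * b + 1) * Real.exp r := by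
    simpa [hL, hX] using e1
  set Y := Q - Complex.exp (2 * a * b) * L with hY
  have hid : mainPrimitive a b w - ε * (Complex.I * (√π / 2 * (1 / a ^ 2 *
      (b * (Real.exp (2 * a * b) - Real.exp (-(2 * a * b))) -
        1 / (2 * a) * (Real.exp (2 * a * b) + Real.exp (-(2 * a * b))))) : ℝ)) =
      ((1 / a ^ 2 : ℝ) : ℂ) * (v * Complex.exp (a ^ 2 * w + b ^ 2 / w) +
        (((-(1 / (2 * a)) - b : ℝ) : ℂ) * X + ((b - 1 / (2 * a) : ℝ) : ℂ) * Y)) := by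
    have hP : P = X + Complex.exp (-(2 * a * b)) * L := by rw [hX]; ring
    have hQ : Q = Y + Complex.exp (2 * a * b) * L := by rw [hY]; ring
    rw [mainPrimitive]
    change 1 / (a : ℂ) ^ 2 * (v * Complex.exp (a ^ 2 * w + b ^ 2 / w) - 1 / (2 * a) * (P + Q) +
      b * (Q - P)) - _ = _
    rw [hP, hQ, hL]
    push_cast
    ring
  have ha0 : 0 < a := by linarith
  have hinv : 1 / (2 * a) ≤ 1 / 100 := by
    rw [div_le_div_iff₀ (by positivity) (by norm_num)]
    linarith
  have hinv0 : 0 < 1 / (2 * a) := by positivity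
  have hE := Real.exp_pos r
  have hcX : ‖((-(1 / (2 * a)) - b : ℝ) : ℂ) * X‖ ≤
      53 / 100 * ((a + 3 / 2 * b + 1) * Real.exp r) := by
    rw [norm_mul, Complex.norm_real, Real.norm_eq_abs]
    refine mul_le_mul (abs_le.2 ⟨by linarith, by linarith⟩) e1' (norm_nonneg _) (by norm_num)
  have hcY : ‖((b - 1 / (2 * a) : ℝ) : ℂ) * Y‖ ≤ 53 / 100 * ((a + 3 / 2 * b + 1) * Real.exp r) := by
    rw [norm_mul, Complex.norm_real, Real.norm_eq_abs]
    refine mul_le_mul (abs_le.2 ⟨by linarith, by linarith⟩) e2' (norm_nonneg _) (by norm_num)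
  have hvE : ‖v * Complex.exp (a ^ 2 * w + b ^ 2 / w)‖ ≤ Real.exp r := by
    have hn : ‖Complex.exp (a ^ 2 * w + b ^ 2 / w)‖ = Real.exp r := by rw [Complex.norm_exp]
    rw [norm_mul, hn]
    nlinarith
  rw [hid, norm_mul, Complex.norm_real, Real.norm_of_nonneg (by positivity), one_div,
    inv_mul_le_iff₀ (by positivity)]
  refine (norm_add_le _ _).trans ((add_le_add hvE ((norm_add_le _ _).trans
    (add_le_add hcX hcY))).trans ?_)
  have : 1 + 2 * (53 / 100 * (a + 3 / 2 * b + 1)) ≤ a ^ 2 * (1 / 20) := by nlinarith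
  nlinarith

/-- The main integral is a combination of hyperbolic functions up to a small error. -/
theorem norm_integral_mainIntegrand_sub_le {a b : ℝ} (ha : 50 ≤ a) (hb : 0 ≤ b)
    (hb1 : b ≤ 13 / 25) {σ : ℝ} (hσ : 0 < σ) (hσ1 : σ ≤ 1 / 2) :
    ‖(∫ t in (-(1 / 2) : ℝ)..1 / 2, mainIntegrand (a ^ 2) (b ^ 2) (σ + t * Complex.I)) -
      ((√π * (1 / a ^ 2 * (b * (Real.exp (2 * a * b) - Real.exp (-(2 * a * b))) -
        1 / (2 * a) * (Real.exp (2 * a * b) + Real.exp (-(2 * a * b))))) : ℝ) : ℂ)‖ ≤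
      1 / 10 * Real.exp (a ^ 2 * σ + 4 * b ^ 2 * σ) := by
  have hn : ∀ t : ℝ, t ^ 2 = 1 / 4 →
      1 / 2 ≤ ‖(σ + t * Complex.I : ℂ)‖ ∧ ‖(σ + t * Complex.I : ℂ)‖ ≤ 1 ∧
      (a ^ 2 * (σ + t * Complex.I) + b ^ 2 / (σ + t * Complex.I) : ℂ).re ≤
        a ^ 2 * σ + 4 * b ^ 2 * σ := by
    intro t ht
    have hsq : ‖(σ + t * Complex.I : ℂ)‖ ^ 2 = σ ^ 2 + 1 / 4 := by
      rw [← Complex.normSq_eq_norm_sq, Complex.normSq_add_mul_I, ht]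
    have h0 := norm_nonneg (σ + t * Complex.I : ℂ)
    refine ⟨by nlinarith, by nlinarith, ?_⟩
    have : (a ^ 2 * (σ + t * Complex.I) + b ^ 2 / (σ + t * Complex.I) : ℂ) =
        ((a ^ 2 : ℝ) : ℂ) * (σ + t * Complex.I) +
          ((b ^ 2 : ℝ) : ℂ) * (σ + t * Complex.I)⁻¹ := by
      push_cast
      ring
    rw [this, Complex.add_re, Complex.re_ofReal_mul, Complex.re_ofReal_mul, Complex.inv_re,
      Complex.normSq_add_mul_I, ht]
    have hre : (σ + t * Complex.I : ℂ).re = σ := by simp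
    rw [hre]
    have : σ / (σ ^ 2 + 1 / 4) ≤ 4 * σ := by
      rw [div_le_iff₀ (by positivity)]
      nlinarith [pow_pos hσ 3]
    nlinarith [sq_nonneg b]
  obtain ⟨p1, p2, p3⟩ := hn (1 / 2) (by norm_num)
  obtain ⟨q1, q2, q3⟩ := hn (-(1 / 2)) (by norm_num)
  have hp := norm_mainPrimitive_sub_le ha hb hb1 p1 p2 1 (Or.inl ⟨rfl, by simp⟩)
  have hq := norm_mainPrimitive_sub_le ha hb hb1 q1 q2 (-1) (Or.inr ⟨rfl, by simp⟩)
  have hp' := hp.trans (mul_le_mul_of_nonneg_left (Real.exp_le_exp.2 p3) (by norm_num))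
  have hq' := hq.trans (mul_le_mul_of_nonneg_left (Real.exp_le_exp.2 q3) (by norm_num))
  rw [integral_mainIntegrand_eq (by linarith) b hσ]
  set D := 1 / a ^ 2 * (b * (Real.exp (2 * a * b) - Real.exp (-(2 * a * b))) -
        1 / (2 * a) * (Real.exp (2 * a * b) + Real.exp (-(2 * a * b))))
  set U := mainPrimitive a b (σ + (1 / 2 : ℝ) * Complex.I)
  set V := mainPrimitive a b (σ + (-(1 / 2) : ℝ) * Complex.I)
  have hid : -Complex.I * (U - V) - ((√π * D : ℝ) : ℂ) =
      -Complex.I * ((U - (1 : ℝ) * (Complex.I * (√π / 2 * D : ℝ))) -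
        (V - (-1 : ℝ) * (Complex.I * (√π / 2 * D : ℝ)))) := by
    push_cast
    linear_combination (-(√π * D : ℂ)) * Complex.I_sq
  rw [hid, norm_mul, norm_neg, Complex.norm_I, one_mul]
  refine (norm_sub_le _ _).trans ((add_le_add hp' hq').trans (le_of_eq ?_))
  ring

end MainIntegral

section Asymptotics

theorem abs_card_partition_sub_le {n : ℕ} (hn : 500 ≤ n) {z : ℝ} (hz0 : 0 ≤ z)
    (hz : z ^ 2 = π ^ 2 * (2 / 3 * (n - 1 / 24))) :
    |(Fintype.card (Nat.Partition n) : ℝ) - √3 * π ^ 2 / (18 * z ^ 3) *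
      (z * (Real.exp z - Real.exp (-z)) - (Real.exp z + Real.exp (-z)))| ≤
      3 * Real.exp (z / 2) := by
  have hn' : (500 : ℝ) ≤ n := by exact_mod_cast hn
  have hπ := Real.pi_gt_d2
  have hπ' := Real.pi_lt_d2
  have hz40 : 40 ≤ z := by nlinarith
  set b := √(π / 12) with hb
  have hb2 : b ^ 2 = π / 12 := Real.sq_sqrt (by positivity)
  have hb0 : 0 < b := Real.sqrt_pos.2 (by positivity)
  have hb1 : b ≤ 13 / 25 := by nlinarith
  set a := z / (2 * b) with ha
  have hab : 2 * a * b = z := by rw [ha]; field_simp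
  have ha2 : a ^ 2 = 2 * π * (n - 1 / 24) := by
    rw [ha, div_pow, mul_pow, hb2, hz]
    field_simp
    ring
  have ha0 : 0 < a := by positivity
  have ha50 : 50 ≤ a := by nlinarith
  set σ := π / (12 * z) with hσ
  have hσ0 : 0 < σ := by positivity
  have hσ1 : σ ≤ 1 / 60 := by
    have : z ^ 2 ≥ 3000 := by nlinarith
    have hz54 : 54 ≤ z := by nlinarith
    rw [hσ, div_le_div_iff₀ (by positivity) (by norm_num)]
    nlinarith
  have e1 : a ^ 2 * σ = z / 4 := by
    have : (n : ℝ) - 1 / 24 = z ^ 2 * 3 / (2 * π ^ 2) := by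
      rw [hz]; field_simp
    rw [ha2, this, hσ]
    field_simp
    ring
  have e2 : π / (48 * σ) = z / 4 := by
    rw [hσ]; field_simp; ring
  have h1 := norm_card_partition_sub_integral_le n hσ0 hσ1
  have h2 := norm_integral_mainIntegrand_sub_le ha50 hb0.le hb1 hσ0 (hσ1.trans (by norm_num))
  rw [← ha2, ← hb2, e2, e1] at h1
  rw [hab, e1] at h2
  have h3 := (norm_sub_le_norm_sub_add_norm_sub _ _ _).trans (add_le_add h1 h2)
  have hπs : √π = 2 * √3 * b := by
    rw [show π = 2 ^ 2 * 3 * (π / 12) by ring, Real.sqrt_mul (by norm_num),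
      Real.sqrt_mul (by norm_num), Real.sqrt_sq (by norm_num)]
  have hM : √π * (1 / a ^ 2 * (b * (Real.exp z - Real.exp (-z)) -
      1 / (2 * a) * (Real.exp z + Real.exp (-z)))) = √3 * π ^ 2 / (18 * z ^ 3) *
      (z * (Real.exp z - Real.exp (-z)) - (Real.exp z + Real.exp (-z))) := by
    have : π = 12 * b ^ 2 := by rw [hb2]; ring
    rw [hπs, this, ← hab]
    field_simp
    ring
  rw [hM, ← Complex.ofReal_natCast, ← Complex.ofReal_sub, Complex.norm_real,
    Real.norm_eq_abs] at h3
  refine h3.trans ?_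
  have h4 : Real.exp (z / 4 + 4 * b ^ 2 * σ) ≤ Real.exp (z / 2) := by
    rw [Real.exp_le_exp, hb2]
    nlinarith
  rw [show z / 4 + z / 4 = z / 2 by ring]
  linarith [Real.exp_pos (z / 2)]

theorem exists_eq_add_mul {x y C e : ℝ} (he : 0 < e) (h : y ≤ x) (h' : x ≤ y + C * e) :
    ∃ E, x = y + E * e ∧ 0 ≤ E ∧ E ≤ C :=
  ⟨(x - y) / e, by field_simp; ring, div_nonneg (by linarith) he.le, by
    rw [div_le_iff₀ he]; linarith⟩

theorem le_sqrt_one_sub {u r : ℝ} (hu0 : 0 < u) (hu1 : u ≤ 1 / 10000) (hr : 0 < r)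
    (hr2 : r ^ 2 = 1 - u) : 1 - u / 2 - u ^ 2 / 8 - 0.1 * u ^ 3 ≤ r := by
  refine le_of_sq_le_sq ?_ hr.le
  rw [hr2]
  nlinarith [pow_pos hu0 3, pow_pos hu0 4, pow_pos hu0 5, pow_pos hu0 6]

theorem sqrt_one_sub_le {u r : ℝ} (hu0 : 0 < u) (hu1 : u ≤ 1 / 10000)
    (hr2 : r ^ 2 = 1 - u) : r ≤ 1 - u / 2 - u ^ 2 / 8 := by
  refine le_of_sq_le_sq ?_ (by nlinarith)
  rw [hr2]
  nlinarith [pow_pos hu0 3, pow_pos hu0 4]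

theorem one_div_sqrt_expansion {u r : ℝ} (hu0 : 0 < u) (hu1 : u ≤ 1 / 10000) (hr : 0 < r)
    (hr2 : r ^ 2 = 1 - u) : ∃ E, 1 / r = 1 + u / 2 + E * u ^ 2 ∧ 0 ≤ E ∧ E ≤ 0.4 := by
  have hrl := le_sqrt_one_sub hu0 hu1 hr hr2
  have hru := sqrt_one_sub_le hu0 hu1 hr2
  refine exists_eq_add_mul (by positivity) ?_ ?_
  · rw [le_div_iff₀ hr]
    nlinarith [pow_pos hu0 2, pow_pos hu0 3]
  · rw [div_le_iff₀ hr]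
    nlinarith [pow_pos hu0 2, pow_pos hu0 3, pow_pos hu0 4,
      mul_le_mul_of_nonneg_left hrl (by positivity : 0 ≤ 1 + u / 2 + 0.4 * u ^ 2)]

theorem one_div_one_add_sqrt_expansion {u r : ℝ} (hu0 : 0 < u) (hu1 : u ≤ 1 / 10000) (hr : 0 < r)
    (hr2 : r ^ 2 = 1 - u) : ∃ E, 1 / (1 + r) = 1 / 2 + u / 8 + E * u ^ 2 ∧ 0 ≤ E ∧ E ≤ 0.1 := by
  have hrl := le_sqrt_one_sub hu0 hu1 hr hr2
  have hru := sqrt_one_sub_le hu0 hu1 hr2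
  refine exists_eq_add_mul (by positivity) ?_ ?_
  · rw [le_div_iff₀ (by linarith)]
    nlinarith [pow_pos hu0 2, pow_pos hu0 3]
  · rw [div_le_iff₀ (by linarith)]
    nlinarith [pow_pos hu0 2, pow_pos hu0 3, pow_pos hu0 4,
      mul_le_mul_of_nonneg_left hrl (by positivity : 0 ≤ 1 / 2 + u / 8 + 0.1 * u ^ 2)]

theorem exp_factor_expansion {t r : ℝ} (ht : 0 < t) (ht1 : t ≤ 1 / 100) (hr : 0 < r)
    (hr2 : r ^ 2 = 1 - t ^ 2) {α : ℝ} (hα0 : 0 < α) (hα1 : α ≤ 0.53) :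
    ∃ E, Real.exp (-(α * t / (1 + r))) = 1 - α / 2 * t + α ^ 2 / 8 * t ^ 2 -
      (α / 8 + α ^ 3 / 48) * t ^ 3 + E * t ^ 4 ∧ -0.1 ≤ E ∧ E ≤ 0.1 := by
  have ht4 : 0 < t ^ 4 := by positivity
  have ht2 : t ^ 2 ≤ 1 / 10000 := by nlinarith
  have hu0 : 0 < t ^ 2 := by positivity
  obtain ⟨E₃, hE₃, h₃0, h₃⟩ := one_div_one_add_sqrt_expansion hu0 ht2 hr hr2
  set m := 1 / 8 + E₃ * t ^ 2 with hm
  set k := 1 / 2 + t ^ 2 * m with hk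
  have hm0 : 0 ≤ m := by positivity
  have hm1 : m ≤ 0.13 := by nlinarith
  have hk0 : 0 ≤ k := by positivity
  have hk1 : k ≤ 0.51 := by nlinarith
  have hs : α * t / (1 + r) = α * t * k := by
    rw [div_eq_mul_one_div, hE₃, hk, hm]
    ring
  have hs0 : 0 ≤ α * t * k := by positivity
  have hs1 : α * t * k ≤ 1 := (by gcongr : α * t * k ≤ 0.53 * (1 / 100) * 0.51).trans (by norm_num)
  have hexp := Real.exp_bound (x := -(α * t * k)) (by rwa [abs_neg, abs_of_nonneg hs0])
    (n := 4) (by norm_num)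
  simp only [Finset.sum_range_succ, Finset.sum_range_zero, abs_neg, abs_of_nonneg hs0,
    Nat.factorial, Nat.succ_eq_add_one] at hexp
  norm_num at hexp
  rw [hs]
  set ρ := Real.exp (-(α * t * k)) - (1 - α * t * k + (α * t * k) ^ 2 / 2 - (α * t * k) ^ 3 / 6)
    with hρ
  have hρ1 : |ρ| ≤ 0.01 * t ^ 4 := by
    have h1 : (α * t * k) ^ 4 * (5 / 96) ≤ 0.01 * t ^ 4 := by
      have : α ^ 4 * k ^ 4 ≤ 0.53 ^ 4 * 0.51 ^ 4 := by gcongr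
      nlinarith
    refine le_trans (le_of_eq ?_) (hexp.trans h1)
    rw [hρ]
    congr 1
    ring
  have a1 : α * E₃ * t ≤ 0.53 * 0.1 * (1 / 100) := by gcongr
  have a2 : α ^ 2 * m * (k + 1 / 2) ≤ 0.53 ^ 2 * 0.13 * (0.51 + 1 / 2) := by gcongr
  have a3 : α ^ 3 * t * m * (k ^ 2 + k / 2 + 1 / 4) ≤
      0.53 ^ 3 * (1 / 100) * 0.13 * (0.51 ^ 2 + 0.51 / 2 + 1 / 4) := by gcongr
  have b1 : 0 ≤ α * E₃ * t := by positivity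
  have b2 : 0 ≤ α ^ 2 * m * (k + 1 / 2) := by positivity
  have b3 : 0 ≤ α ^ 3 * t * m * (k ^ 2 + k / 2 + 1 / 4) := by positivity
  have hρ2 := abs_le.1 hρ1
  have c1 : ρ / t ^ 4 ≤ 0.01 := by rw [div_le_iff₀ ht4]; exact hρ2.2
  have c2 : -0.01 ≤ ρ / t ^ 4 := by rw [le_div_iff₀ ht4]; linarith
  refine ⟨-(α * E₃ * t) + α ^ 2 * m * (k + 1 / 2) / 2 -
    α ^ 3 * t * m * (k ^ 2 + k / 2 + 1 / 4) / 6 + ρ / t ^ 4, ?_, by linarith, by linarith⟩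
  have : Real.exp (-(α * t * k)) = ρ + (1 - α * t * k + (α * t * k) ^ 2 / 2 -
    (α * t * k) ^ 3 / 6) := by rw [hρ]; ring
  rw [this, add_mul _ (ρ / t ^ 4), div_mul_cancel₀ _ ht4.ne', hk, hm]
  ring

theorem rational_factor_expansion {t r : ℝ} (ht : 0 < t) (ht1 : t ≤ 1 / 100) (hr : 0 < r)
    (hr2 : r ^ 2 = 1 - t ^ 2) {β : ℝ} (hβ0 : 0 < β) (hβ1 : β ≤ 1.93) :
    ∃ E, 1 / r ^ 2 * (1 - t * β / r) =
      1 - β * t + t ^ 2 - 3 * β / 2 * t ^ 3 + E * t ^ 4 ∧ -0.1 ≤ E ∧ E ≤ 1.1 := by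
  have ht2 : t ^ 2 ≤ 1 / 10000 := by nlinarith
  have hu0 : 0 < t ^ 2 := by positivity
  have hr99 : 0.9999 ≤ r := by nlinarith
  obtain ⟨E₁, hE₁, h₁0, h₁⟩ : ∃ E, 1 / r ^ 2 = 1 + t ^ 2 + E * t ^ 4 ∧ 0 ≤ E ∧ E ≤ 1.01 := by
    refine ⟨1 / (1 - t ^ 2), ?_, ?_, ?_⟩
    · rw [hr2]
      have : 1 - t ^ 2 ≠ 0 := by nlinarith
      field_simp
      ring
    · exact div_nonneg zero_le_one (by linarith)
    · rw [div_le_iff₀ (by linarith)]; linarith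
  obtain ⟨E₂, hE₂, h₂0, h₂⟩ := one_div_sqrt_expansion hu0 ht2 hr hr2
  have hfac0 : 0 ≤ 1 - t * β / r := by
    rw [sub_nonneg, div_le_one hr]
    nlinarith
  have hfac1 : 1 - t * β / r ≤ 1 := by
    rw [sub_le_self_iff]
    positivity
  have a1 : β * t * (E₂ + 1 / 2 + E₂ * t ^ 2) ≤
      1.93 * (1 / 100) * (0.4 + 1 / 2 + 0.4 * (1 / 10000)) := by
    gcongr
  have b1 : 0 ≤ β * t * (E₂ + 1 / 2 + E₂ * t ^ 2) := by positivity
  have a2 : E₁ * (1 - t * β / r) ≤ 1.01 * 1 := by gcongr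
  have b2 : 0 ≤ E₁ * (1 - t * β / r) := by positivity
  refine ⟨-(β * t * (E₂ + 1 / 2 + E₂ * t ^ 2)) + E₁ * (1 - t * β / r), ?_, by linarith, by linarith⟩
  rw [hE₁, div_eq_mul_one_div (t * β), hE₂]
  ring

/-- The rescaled main term, in the variable `t = 1 / √(24 n)`, agrees with its cubic Taylor
polynomial up to `O(t ^ 4)`. -/
theorem abs_mainTerm_sub_taylor_le {t r : ℝ} (ht : 0 < t) (ht1 : t ≤ 1 / 100) (hr : 0 < r)
    (hr2 : r ^ 2 = 1 - t ^ 2) {α β : ℝ} (hα : 0.52 ≤ α) (hα1 : α ≤ 0.53) (hαβ : α * β = 1) :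
    |1 / r ^ 2 * (1 - t * β / r) * Real.exp (-(α * t / (1 + r))) -
      (1 - (α / 2 + β) * t + (α ^ 2 / 8 + 3 / 2) * t ^ 2 -
        (α ^ 3 / 48 + 3 * α / 4 + 3 * β / 2) * t ^ 3)| ≤ 4.5 * t ^ 4 := by
  have ht4 : 0 < t ^ 4 := by positivity
  have ht2 : t ^ 2 ≤ 1 / 10000 := by nlinarith
  have hα0 : 0 < α := by linarith
  have hβ' : β = 1 / α := by field_simp; linarith
  have hβ0 : 0 < β := by rw [hβ']; positivity
  have hβ1 : β ≤ 1.93 := by nlinarith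
  obtain ⟨E₅, hE₅, h₅0, h₅⟩ := exp_factor_expansion ht ht1 hr hr2 hα0 hα1
  obtain ⟨E₇, hE₇, h₇0, h₇⟩ := rational_factor_expansion ht ht1 hr hr2 hβ0 hβ1
  have hs0 : 0 ≤ α * t / (1 + r) := by positivity
  rw [hE₇]
  set X := Real.exp (-(α * t / (1 + r))) with hX
  set γ := α / 8 + α ^ 3 / 48 with hγ
  have hγ0 : 0 ≤ γ := by positivity
  have hγ1 : γ ≤ 0.53 / 8 + 0.53 ^ 3 / 48 := by rw [hγ]; gcongr
  have hid : (1 - β * t + t ^ 2 - 3 * β / 2 * t ^ 3 + E₇ * t ^ 4) * X -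
      (1 - (α / 2 + β) * t + (α ^ 2 / 8 + 3 / 2) * t ^ 2 -
        (α ^ 3 / 48 + 3 * α / 4 + 3 * β / 2) * t ^ 3) =
      ((β * γ + α ^ 2 / 8 + 3 / 4 - t * (γ + 3 / 16 * α + E₅ * β) + t ^ 2 * (3 / 2 * β * γ)) +
        E₅ * (1 + t ^ 2 - 3 * β / 2 * t ^ 3) + E₇ * X) * t ^ 4 := by
    rw [hE₅, hγ, hβ']
    field_simp
    ring
  rw [hid, abs_mul, abs_of_pos ht4]
  refine mul_le_mul_of_nonneg_right ?_ ht4.le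
  have x0 : 0 < X := Real.exp_pos _
  have x1 : X ≤ 1 := Real.exp_le_one_iff.2 (by linarith)
  have y1 : β * γ ≤ 1.93 * (0.53 / 8 + 0.53 ^ 3 / 48) := by gcongr
  have y0 : 0 ≤ β * γ := by positivity
  have z1 : β * t ^ 3 ≤ 1.93 * (1 / 100) ^ 3 := by gcongr
  have z0 : 0 ≤ β * t ^ 3 := by positivity
  have v1 : t ^ 2 * (3 / 2 * β * γ) ≤ 1 / 10000 * 1 := by
    gcongr
    linarith
  have v0 : 0 ≤ t ^ 2 * (3 / 2 * β * γ) := by positivity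
  have w5 : |E₅ * β| ≤ 0.1 * 1.93 := by
    rw [abs_mul, abs_of_pos hβ0]
    exact mul_le_mul (abs_le.2 ⟨by linarith, h₅⟩) hβ1 hβ0.le (by norm_num)
  have w6 : |t * (γ + 3 / 16 * α + E₅ * β)| ≤ 1 / 100 * 1 := by
    rw [abs_mul, abs_of_pos ht]
    refine mul_le_mul ht1 ?_ (abs_nonneg _) (by norm_num)
    have := abs_le.1 w5
    exact abs_le.2 ⟨by linarith, by linarith⟩
  have w7 : |E₅ * (1 + t ^ 2 - 3 * β / 2 * t ^ 3)| ≤ 0.1 * 1.1 := by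
    rw [abs_mul]
    refine mul_le_mul (abs_le.2 ⟨by linarith, h₅⟩) ?_ (abs_nonneg _) (by norm_num)
    exact abs_le.2 ⟨by linarith [sq_nonneg t], by linarith⟩
  have w8 : |E₇ * X| ≤ 1.1 * 1 := by
    rw [abs_mul, abs_of_pos x0]
    exact mul_le_mul (abs_le.2 ⟨by linarith, h₇⟩) x1 x0.le (by norm_num)
  have l6 := abs_le.1 w6
  have l7 := abs_le.1 w7
  have l8 := abs_le.1 w8
  have hα2 : α ^ 2 ≤ 0.53 ^ 2 := by gcongr
  exact abs_le.2 ⟨by linarith [sq_nonneg α], by linarith⟩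

end Asymptotics

section Coefficients

theorem sum_c_div_rpow_eq {n : ℕ} (hn : 0 < n) :
    ∑ m ∈ range 4, c m / (n : ℝ) ^ ((m : ℝ) / 2) =
      1 - (π / 6 / 2 + 6 / π) * (1 / √(24 * n)) + ((π / 6) ^ 2 / 8 + 3 / 2) * (1 / √(24 * n)) ^ 2 -
        ((π / 6) ^ 3 / 48 + 3 * (π / 6) / 4 + 3 * (6 / π) / 2) * (1 / √(24 * n)) ^ 3 := by
  have hn' : (0 : ℝ) < n := by exact_mod_cast hn
  have hπ := Real.pi_pos
  set s := √(n : ℝ) with hs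
  have hs0 : 0 < s := Real.sqrt_pos.2 hn'
  have h6 : √(6 : ℝ) ^ 2 = 6 := Real.sq_sqrt (by norm_num)
  have h60 : 0 < √(6 : ℝ) := Real.sqrt_pos.2 (by norm_num)
  have h24 : √(24 * n : ℝ) = 2 * √6 * s := by
    rw [show (24 : ℝ) * n = 2 ^ 2 * 6 * n by ring, Real.sqrt_mul (by norm_num),
      Real.sqrt_mul (by norm_num), Real.sqrt_sq (by norm_num)]
  have hpow : ∀ m : ℕ, (n : ℝ) ^ ((m : ℝ) / 2) = s ^ m := fun m => by
    rw [hs, Real.sqrt_eq_rpow, ← Real.rpow_natCast, ← Real.rpow_mul hn'.le]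
    congr 1
    ring
  simp only [hpow, h24]
  have c0 : c 0 = 1 := by
    simp [c]
  have c1 : c 1 = -(π / 6 / 2 + 6 / π) * (1 / (2 * √6)) := by
    simp [c, Finset.sum_range_succ]
    field_simp
    ring
  have c2 : c 2 = ((π / 6) ^ 2 / 8 + 3 / 2) * (1 / (2 * √6)) ^ 2 := by
    simp [c, Finset.sum_range_succ, Nat.factorial, Nat.choose]
    field_simp
    ring
  have c3 : c 3 = -((π / 6) ^ 3 / 48 + 3 * (π / 6) / 4 + 3 * (6 / π) / 2) * (1 / (2 * √6)) ^ 3 := by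
    simp [c, Finset.sum_range_succ, Nat.factorial, Nat.choose]
    field_simp
    ring
  simp only [Finset.sum_range_succ, Finset.sum_range_zero, c0, c1, c2, c3]
  field_simp
  ring

end Coefficients

section LargeIndex

theorem pow_six_le_exp {s : ℝ} (hs : 22.36 ≤ s) : 4400 * s ^ 6 ≤ Real.exp (1.28 * s) := by
  have h1 : 4.05 * s ≤ Real.exp (1.28 * s / 6) := by
    have e1 : (54.5 : ℝ) ≤ Real.exp 4 := by
      have := Real.exp_one_gt_d9
      rw [show (4 : ℝ) = (4 : ℕ) * 1 by norm_num, Real.exp_nat_mul]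
      exact (by norm_num : (54.5 : ℝ) ≤ 2.718 ^ 4).trans (by gcongr; linarith)
    have e2 := Real.quadratic_le_exp_of_nonneg (x := 1.28 * s / 6 - 4) (by linarith)
    rw [show 1.28 * s / 6 = 4 + (1.28 * s / 6 - 4) by ring, Real.exp_add]
    refine le_trans ?_ (mul_le_mul e1 e2 (by nlinarith) (Real.exp_pos _).le)
    nlinarith
  calc 4400 * s ^ 6 ≤ (4.05 * s) ^ 6 := by
        rw [mul_pow]
        gcongr
        norm_num
    _ ≤ Real.exp (1.28 * s / 6) ^ 6 := by gcongr
    _ = Real.exp (1.28 * s) := by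
        rw [← Real.exp_nat_mul]
        congr 1
        push_cast
        ring

theorem abs_rescaled_sub_mainTerm_le {n : ℕ} (hn : 500 ≤ n) {x r t : ℝ} (hr9 : 0.999 ≤ r)
    (hr1 : r ≤ 1) (hx50 : 50 ≤ x) (ht0 : 0 < t) (hxt : x = π / 6 / t)
    (hx2 : x ^ 2 = π ^ 2 * (2 * n / 3))
    (hz2 : (x * r) ^ 2 = π ^ 2 * (2 / 3 * (n - 1 / 24))) :
    |4 * √3 * n * Real.exp (-x) * (Fintype.card (Nat.Partition n) : ℝ) -
      1 / r ^ 2 * (1 - t * (6 / π) / r) * Real.exp (x * r - x)| ≤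
      22 * (n * Real.exp (-(x / 2))) := by
  have hn' : (500 : ℝ) ≤ n := by exact_mod_cast hn
  have hr0 : 0 < r := by linarith
  obtain ⟨z, hz⟩ : ∃ z, z = x * r := ⟨_, rfl⟩
  rw [← hz] at hz2 ⊢
  have hz40 : 40 ≤ z := by nlinarith
  have hz0 : 0 < z := by linarith
  have hzx : z ≤ x := by nlinarith
  have hmain := abs_card_partition_sub_le hn hz0.le hz2
  have hπ := Real.pi_pos
  have h1 : t * (6 / π) / r = 1 / z := by rw [hz, hxt]; field_simp
  rw [h1]
  generalize (Fintype.card (Nat.Partition n) : ℝ) = P at *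
  set K := 4 * √3 * n * Real.exp (-x) with hK
  have hK0 : 0 < K := by positivity
  set M := √3 * π ^ 2 / (18 * z ^ 3) *
      (z * (Real.exp z - Real.exp (-z)) - (Real.exp z + Real.exp (-z))) with hM
  set G := 1 / r ^ 2 * (1 - 1 / z) * Real.exp (z - x) with hG
  have h3 : √(3 : ℝ) ^ 2 = 3 := Real.sq_sqrt (by norm_num)
  have hKM : K * M = G - 1 / r ^ 2 * (1 + 1 / z) * Real.exp (-z) * Real.exp (-x) := by
    have h2 : 1 / r ^ 2 = π ^ 2 * (2 * n / 3) / z ^ 2 := by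
      rw [← hx2, hz]
      field_simp
    rw [hG, h2, hK, hM, sub_eq_add_neg z x, Real.exp_add]
    field_simp
    rw [h3]
    ring
  have hE : Real.exp (-x) * Real.exp (x / 2) = Real.exp (-(x / 2)) := by
    rw [← Real.exp_add]; congr 1; ring
  have hEpos := Real.exp_pos (-(x / 2))
  have b1 : |K * P - K * M| ≤ 21 * (n * Real.exp (-(x / 2))) := by
    rw [← mul_sub, abs_mul, abs_of_pos hK0]
    have : Real.exp (z / 2) ≤ Real.exp (x / 2) := Real.exp_le_exp.2 (by linarith)
    have hs3 : √(3 : ℝ) ≤ 1.75 := Real.sqrt_le_iff.2 (by norm_num)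
    calc K * |P - M| ≤ K * (3 * Real.exp (x / 2)) :=
          mul_le_mul_of_nonneg_left (hmain.trans (by linarith)) hK0.le
      _ = 12 * √3 * (n * Real.exp (-(x / 2))) := by rw [← hE, hK]; ring
      _ ≤ 21 * (n * Real.exp (-(x / 2))) := by
          gcongr
          linarith
  have b2 : |K * M - G| ≤ 1 * (n * Real.exp (-(x / 2))) := by
    have hz1 : 1 / z ≤ 1 := by rw [div_le_one hz0]; linarith
    have hr3 : 1 / r ^ 2 ≤ 2 := by
      rw [div_le_iff₀ (by positivity)]
      nlinarith
    have e1 : Real.exp (-z) ≤ 1 := Real.exp_le_one_iff.2 (by linarith)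
    have e2 : Real.exp (-x) ≤ Real.exp (-(x / 2)) := Real.exp_le_exp.2 (by linarith)
    rw [hKM, sub_sub_cancel_left, abs_neg, abs_of_pos (by positivity)]
    calc _ ≤ 2 * (1 + 1) * 1 * Real.exp (-(x / 2)) := by gcongr
      _ ≤ _ := by nlinarith
  calc |K * P - G| ≤ |K * P - K * M| + |K * M - G| := abs_sub_le _ _ _
    _ ≤ _ := by linarith

theorem abs_R_four_le_of_le {n : ℕ} (hn : 500 ≤ n) : |R 4 n| ≤ 0.0129 / (n : ℝ) ^ 2 := by
  have hn' : (500 : ℝ) ≤ n := by exact_mod_cast hn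
  have hn0 : (0 : ℝ) < n := by linarith
  have hπ := Real.pi_gt_d2
  have hπ' := Real.pi_lt_d2
  have hsn : √(n : ℝ) ^ 2 = n := Real.sq_sqrt hn0.le
  have hs22 : 22.36 ≤ √(n : ℝ) := Real.le_sqrt_of_sq_le (by norm_num; linarith)
  set t := 1 / √(24 * n : ℝ) with ht
  have h24 : √(24 * n : ℝ) ^ 2 = 24 * n := Real.sq_sqrt (by positivity)
  have h240 : 0 < √(24 * n : ℝ) := Real.sqrt_pos.2 (by positivity)
  have ht0 : 0 < t := by positivity
  have ht2 : t ^ 2 = 1 / (24 * n) := by rw [ht, div_pow, h24, one_pow]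
  have ht1 : t ≤ 1 / 100 := by
    rw [ht, div_le_div_iff₀ h240 (by norm_num), one_mul, one_mul]
    exact Real.le_sqrt_of_sq_le (by norm_num; linarith)
  set r := √(1 - t ^ 2) with hr
  have hr2 : r ^ 2 = 1 - t ^ 2 := Real.sq_sqrt (by nlinarith)
  have hr0 : 0 < r := Real.sqrt_pos.2 (by nlinarith)
  have hr1 : r ≤ 1 := by nlinarith
  have hr9 : 0.999 ≤ r := by nlinarith
  set x := π * √(2 * n / 3) with hx
  have hxt : x = π / 6 / t := by
    have : √(2 * n / 3 : ℝ) = √(24 * n) / 6 := by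
      rw [show (2 * n / 3 : ℝ) = 24 * n / 6 ^ 2 by ring, Real.sqrt_div (by positivity),
        Real.sqrt_sq (by norm_num)]
    rw [hx, this, ht]
    field_simp
  have hx2 : x ^ 2 = π ^ 2 * (2 * n / 3) := by
    rw [hx, mul_pow, Real.sq_sqrt (by positivity)]
  have hxs : 1.28 * √(n : ℝ) ≤ x / 2 := by
    have hx0 : 0 < x := by positivity
    refine le_of_sq_le_sq ?_ (by positivity)
    rw [mul_pow, hsn, div_pow, hx2]
    have : 3.14 ^ 2 ≤ π ^ 2 := by gcongr
    nlinarith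
  have hx50 : 50 ≤ x := by linarith
  set z := x * r with hz
  have hz2 : z ^ 2 = π ^ 2 * (2 / 3 * (n - 1 / 24)) := by
    rw [hz, mul_pow, hx2, hr2, ht2]
    field_simp
  have htaylor := abs_mainTerm_sub_taylor_le ht0 ht1 hr0 hr2 (α := π / 6) (β := 6 / π)
    (by linarith) (by linarith) (by field_simp)
  rw [← sum_c_div_rpow_eq (by omega : 0 < n)] at htaylor
  have hzr : -(π / 6 * t / (1 + r)) = z - x := by
    rw [hz, hxt]
    field_simp
    linear_combination -hr2
  rw [hzr] at htaylor
  have hmain := abs_rescaled_sub_mainTerm_le hn hr9 hr1 hx50 ht0 hxt hx2 hz2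
  have b3 : n * Real.exp (-(x / 2)) ≤ 1 / 4400 / (n : ℝ) ^ 2 := by
    have h1 := (pow_six_le_exp hs22).trans (Real.exp_le_exp.2 hxs)
    rw [show √(n : ℝ) ^ 6 = (√(n : ℝ) ^ 2) ^ 3 by ring, hsn] at h1
    rw [Real.exp_neg, div_div, ← div_eq_mul_inv, div_le_div_iff₀ (Real.exp_pos _) (by positivity)]
    linarith
  have b4 : 4.5 * t ^ 4 = 4.5 / 576 / (n : ℝ) ^ 2 := by
    rw [show t ^ 4 = (t ^ 2) ^ 2 by ring, ht2]
    field_simp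
    norm_num
  refine (abs_sub_le _ _ _).trans ((add_le_add hmain htaylor).trans ?_)
  rw [b4]
  calc _ ≤ 22 * (1 / 4400 / (n : ℝ) ^ 2) + 4.5 / 576 / (n : ℝ) ^ 2 := by linarith
    _ = (22 / 4400 + 4.5 / 576) / (n : ℝ) ^ 2 := by ring
    _ ≤ _ := by
        gcongr
        norm_num

end LargeIndex

section PartitionTable

/-- The coefficients of `pentagonalSeries ℤ` in degrees `1, …, 499`. -/
def eulerCoeffTail : List ℤ :=
  [
    -1, -1, 0, 0, 1, 0, 1, 0, 0, 0, 0, -1, 0, 0, -1, 0, 0, 0, 0, 0, 0, 1, 0, 0, 0, 1, 0, 0, 0, 0,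
    0, 0, 0, 0, -1, 0, 0, 0, 0, -1, 0, 0, 0, 0, 0, 0, 0, 0, 0, 0, 1, 0, 0, 0, 0, 0, 1, 0, 0, 0, 0,
    0, 0, 0, 0, 0, 0, 0, 0, -1, 0, 0, 0, 0, 0, 0, -1, 0, 0, 0, 0, 0, 0, 0, 0, 0, 0, 0, 0, 0, 0, 1,
    0, 0, 0, 0, 0, 0, 0, 1, 0, 0, 0, 0, 0, 0, 0, 0, 0, 0, 0, 0, 0, 0, 0, 0, -1, 0, 0, 0, 0, 0, 0,
    0, 0, -1, 0, 0, 0, 0, 0, 0, 0, 0, 0, 0, 0, 0, 0, 0, 0, 0, 0, 0, 1, 0, 0, 0, 0, 0, 0, 0, 0, 0,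
    1, 0, 0, 0, 0, 0, 0, 0, 0, 0, 0, 0, 0, 0, 0, 0, 0, 0, 0, 0, 0, -1, 0, 0, 0, 0, 0, 0, 0, 0, 0,
    0, -1, 0, 0, 0, 0, 0, 0, 0, 0, 0, 0, 0, 0, 0, 0, 0, 0, 0, 0, 0, 0, 0, 0, 1, 0, 0, 0, 0, 0, 0,
    0, 0, 0, 0, 0, 1, 0, 0, 0, 0, 0, 0, 0, 0, 0, 0, 0, 0, 0, 0, 0, 0, 0, 0, 0, 0, 0, 0, 0, 0, -1,
    0, 0, 0, 0, 0, 0, 0, 0, 0, 0, 0, 0, -1, 0, 0, 0, 0, 0, 0, 0, 0, 0, 0, 0, 0, 0, 0, 0, 0, 0, 0,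
    0, 0, 0, 0, 0, 0, 0, 0, 1, 0, 0, 0, 0, 0, 0, 0, 0, 0, 0, 0, 0, 0, 1, 0, 0, 0, 0, 0, 0, 0, 0,
    0, 0, 0, 0, 0, 0, 0, 0, 0, 0, 0, 0, 0, 0, 0, 0, 0, 0, 0, 0, -1, 0, 0, 0, 0, 0, 0, 0, 0, 0, 0,
    0, 0, 0, 0, -1, 0, 0, 0, 0, 0, 0, 0, 0, 0, 0, 0, 0, 0, 0, 0, 0, 0, 0, 0, 0, 0, 0, 0, 0, 0, 0,
    0, 0, 0, 0, 1, 0, 0, 0, 0, 0, 0, 0, 0, 0, 0, 0, 0, 0, 0, 0, 1, 0, 0, 0, 0, 0, 0, 0, 0, 0, 0,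
    0, 0, 0, 0, 0, 0, 0, 0, 0, 0, 0, 0, 0, 0, 0, 0, 0, 0, 0, 0, 0, 0, -1, 0, 0, 0, 0, 0, 0, 0, 0,
    0, 0, 0, 0, 0, 0, 0, 0, -1, 0, 0, 0, 0, 0, 0, 0, 0, 0, 0, 0, 0, 0, 0, 0, 0, 0, 0, 0, 0, 0, 0,
    0, 0, 0, 0, 0, 0, 0, 0, 0, 0, 0, 0, 1, 0, 0, 0, 0, 0, 0, 0, 0, 0, 0, 0, 0, 0, 0, 0, 0, 0, 1,
    0, 0, 0, 0]

/-- The values `p 1, …, p 499` of the partition function. -/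
def partitionTail : List ℕ :=
  [
    1, 2, 3, 5, 7, 11, 15, 22, 30, 42, 56, 77, 101, 135, 176, 231, 297, 385, 490, 627, 792, 1002,
    1255, 1575, 1958, 2436, 3010, 3718, 4565, 5604, 6842, 8349, 10143, 12310, 14883, 17977, 21637,
    26015, 31185, 37338, 44583, 53174, 63261, 75175, 89134, 105558, 124754, 147273, 173525,
    204226, 239943, 281589, 329931, 386155, 451276, 526823, 614154, 715220, 831820, 966467,
    1121505, 1300156, 1505499, 1741630, 2012558, 2323520, 2679689, 3087735, 3554345, 4087968,
    4697205, 5392783, 6185689, 7089500, 8118264, 9289091, 10619863, 12132164, 13848650, 15796476,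
    18004327, 20506255, 23338469, 26543660, 30167357, 34262962, 38887673, 44108109, 49995925,
    56634173, 64112359, 72533807, 82010177, 92669720, 104651419, 118114304, 133230930, 150198136,
    169229875, 190569292, 214481126, 241265379, 271248950, 304801365, 342325709, 384276336,
    431149389, 483502844, 541946240, 607163746, 679903203, 761002156, 851376628, 952050665,
    1064144451, 1188908248, 1327710076, 1482074143, 1653668665, 1844349560, 2056148051,
    2291320912, 2552338241, 2841940500, 3163127352, 3519222692, 3913864295, 4351078600,
    4835271870, 5371315400, 5964539504, 6620830889, 7346629512, 8149040695, 9035836076,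
    10015581680, 11097645016, 12292341831, 13610949895, 15065878135, 16670689208, 18440293320,
    20390982757, 22540654445, 24908858009, 27517052599, 30388671978, 33549419497, 37027355200,
    40853235313, 45060624582, 49686288421, 54770336324, 60356673280, 66493182097, 73232243759,
    80630964769, 88751778802, 97662728555, 107438159466, 118159068427, 129913904637, 142798995930,
    156919475295, 172389800255, 189334822579, 207890420102, 228204732751, 250438925115,
    274768617130, 301384802048, 330495499613, 362326859895, 397125074750, 435157697830,
    476715857290, 522115831195, 571701605655, 625846753120, 684957390936, 749474411781,
    819876908323, 896684817527, 980462880430, 1071823774337, 1171432692373, 1280011042268,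
    1398341745571, 1527273599625, 1667727404093, 1820701100652, 1987276856363, 2168627105469,
    2366022741845, 2580840212973, 2814570987591, 3068829878530, 3345365983698, 3646072432125,
    3972999029388, 4328363658647, 4714566886083, 5134205287973, 5590088317495, 6085253859260,
    6622987708040, 7206841706490, 7840656226137, 8528581302375, 9275102575355, 10085065885767,
    10963707205259, 11916681236278, 12950095925895, 14070545699287, 15285151248481,
    16601598107914, 18028182516671, 19573856161145, 21248279009367, 23061871173849,
    25025873760111, 27152408925615, 29454549941750, 31946390696157, 34643126322519,
    37561133582570, 40718063627362, 44132934884255, 47826239745920, 51820051838712,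
    56138148670947, 60806135438329, 65851585970275, 71304185514919, 77195892663512,
    83561103925871, 90436839668817, 97862933703585, 105882246722733, 114540884553038,
    123888443077259, 133978259344888, 144867692496445, 156618412527946, 169296722391554,
    182973889854026, 197726516681672, 213636919820625, 230793554364681, 249291451168559,
    269232701252579, 290726957916112, 313891991306665, 338854264248680, 365749566870782,
    394723676655357, 425933084409356, 459545750448675, 495741934760846, 534715062908609,
    576672674947168, 621837416509615, 670448123060170, 722760953690372, 779050629562167,
    839611730366814, 904760108316360, 974834369944625, 1050197489931117, 1131238503938606,
    1218374349844333, 1312051800816215, 1412749565173450, 1520980492851175, 1637293969337171,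
    1762278433057269, 1896564103591584, 2040825852575075, 2195786311682516, 2362219145337711,
    2540952590045698, 2732873183547535, 2938929793929555, 3160137867148997, 3397584011986773,
    3652430836071053, 3925922161489422, 4219388528587095, 4534253126900886, 4872038056472084,
    5234371069753672, 5622992691950605, 6039763882095515, 6486674127079088, 6965850144195831,
    7479565078510584, 8030248384943040, 8620496275465025, 9253082936723602, 9930972392403501,
    10657331232548839, 11435542077822104, 12269218019229465, 13162217895057704, 14118662665280005,
    15142952738857194, 16239786535829663, 17414180133147295, 18671488299600364, 20017426762576945,
    21458096037352891, 23000006655487337, 24650106150830490, 26415807633566326, 28305020340996003,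
    30326181989842964, 32488293351466654, 34800954869440830, 37274405776748077, 39919565526999991,
    42748078035954696, 45772358543578028, 49005643635237875, 52462044228828641, 56156602112874289,
    60105349839666544, 64325374609114550, 68834885946073850, 73653287861850339, 78801255302666615,
    84300815636225119, 90175434980549623, 96450110192202760, 103151466321735325,
    110307860425292772, 117949491546113972, 126108517833796355, 134819180623301520,
    144117936527873832, 154043597379576030, 164637479165761044, 175943559810422753,
    188008647052292980, 200882556287683159, 214618299743286299, 229272286871217150,
    244904537455382406, 261578907351144125, 279363328483702152, 298330063062758076,
    318555973788329084, 340122810048577428, 363117512048110005, 387632532919029223,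
    413766180933342362, 441622981929358437, 471314064268398780, 502957566506000020,
    536679070310691121, 572612058898037559, 610898403751884101, 651688879997206959,
    695143713458946040, 741433159884081684, 790738119649411319, 843250788562528427,
    899175348396088349, 958728697912338045, 1022141228367345362, 1089657644424399782,
    1161537834849962850, 1238057794119125085, 1319510599727473500, 1406207446561484054,
    1498478743590581081, 1596675274490756791, 1701169427975813525, 1812356499739472950,
    1930656072350465812, 2056513475336633805, 2190401332423765131, 2332821198543892336,
    2484305294265418180, 2645418340688763701, 2816759503217942792, 2998964447736452194,
    3192707518433532826, 3398704041358160275, 3617712763867604423, 3850538434667429186,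
    4098034535626594791, 4361106170762284114, 4640713124699623515, 4937873096788191655,
    5253665124416975163, 5589233202595404488, 5945790114707874597, 6324621482504294325,
    6727090051741041926, 7154640222653942321, 7608802843339879269, 8091200276484465581,
    8603551759348655060, 9147679068859117602, 9725512513742021729, 10339097267123947241,
    10990600063775926994, 11682316277192317780, 12416677403151190382, 13196258966925435702,
    14023788883518847344, 14902156290309948968, 15834420884488187770, 16823822787139235544,
    17873792969689876004, 18987964267331664557, 20170183018805933659, 21424521360255636320,
    22755290216580025259, 24167053021441363961, 25664640213837714846, 27253164546230421739,
    28938037257084798150, 30724985147095051099, 32620068617410232189, 34629700713903575934,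
    36760667241831527309, 39020148000237259665, 41415739207102358378, 43955477170518116534,
    46647863284229267991, 49501890409405150715, 52527070729108240605, 55733465144636286656,
    59131714309169618645, 62733071376043079215, 66549436566966297367, 70593393646562135510,
    74878248419470886233, 79418069346443402240, 84227730407729499781, 89322956321353645667,
    94720370257893471820, 100437544171752847604, 106493051905239118581, 112906525199196103354,
    119698712782720205954, 126891542690981418000, 134508188001572923840, 142573136155347404229,
    151112262071917313678, 160152905244553715585, 169723951046458040965, 179855916453958267598,
    190581040442651931034, 201933379285114688629, 213948907032733069132, 226665621435831345565,
    240123655613925192081, 254365395758574199975, 269435605212954994471, 285381555241961986287,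
    302253162872576636605, 320103136152993290544, 338987127249525432549, 358963893768162876613,
    380095468763120598477, 402447339861711475160, 426088638015652413417, 451092336355096099864,
    477535459708164115593, 505499305314204629558, 535069675351607262125, 566337121865805599675,
    599397204782301852926, 634350763653787028583, 671304203896731807232, 710369798236628238005,
    751666004194993125591, 795317798414758232180, 841457028742823649455, 890222784951928088294,
    941761789114997698055, 996228806608573411012, 1053787078862455346513, 1114608778936426484248,
    1178875491155735802646, 1246778716001272919665, 1318520401612270233223,
    1394313503224447816939, 1474382572040363953132, 1558964374994977806173,
    1648308547066172438760, 1742678277747760981187, 1842351033503159891466,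
    1947619317987658064007, 2058791472042884901563, 2176192515439287461625]

/-- The sum of the products of corresponding entries. -/
def signedSum : List ℕ → List ℤ → ℤ
  | a :: l, b :: e => a * b + signedSum l e
  | _, _ => 0

/-- Starting from the reversed list `l` of earlier values, check that every further value satisfies
the recurrence with coefficients `1 :: e`. -/
def satisfiesRecurrence (e : List ℤ) : List ℕ → List ℕ → Bool
  | _, [] => true
  | l, v :: r => decide (v + signedSum l e = 0) && satisfiesRecurrence e (v :: l) r

theorem satisfiesRecurrence_partitionTail :
    satisfiesRecurrence eulerCoeffTail [1] partitionTail = true := by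
  decide +kernel

theorem abs_le_of_pentagonal_lt {k : ℤ} (h : pentagonal k < 500) : -18 ≤ k ∧ k ≤ 18 := by
  have h1 := two_mul_natCast_pentagonal k
  have h2 : (pentagonal k : ℤ) < 500 := by exact_mod_cast h
  constructor <;> nlinarith

theorem getD_eulerCoeffTail_pentagonal :
    ∀ k ∈ Finset.Icc (-18 : ℤ) 18, pentagonal k < 500 →
      (1 :: eulerCoeffTail).getD (pentagonal k) 0 = Int.negOnePow k := by
  decide +kernel

theorem exists_pentagonal_of_getD_eulerCoeffTail_ne_zero :
    ∀ j ∈ Finset.range 500, (1 :: eulerCoeffTail).getD j 0 ≠ 0 →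
      ∃ k ∈ Finset.Icc (-18 : ℤ) 18, pentagonal k = j := by
  decide +kernel

theorem coeff_pentagonalSeries_eq_getD {j : ℕ} (hj : j < 500) :
    (PowerSeries.pentagonalSeries ℤ).coeff j = (1 :: eulerCoeffTail).getD j 0 := by
  by_cases h : j ∈ Set.range pentagonal
  · obtain ⟨k, rfl⟩ := h
    rw [PowerSeries.coeff_pentagonalSeries_pentagonal, getD_eulerCoeffTail_pentagonal k
      (Finset.mem_Icc.2 (abs_le_of_pentagonal_lt hj)) hj, Int.cast_id]
  · rw [PowerSeries.coeff_pentagonalSeries_eq_zero ℤ h]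
    by_contra h0
    obtain ⟨k, -, hk⟩ := exists_pentagonal_of_getD_eulerCoeffTail_ne_zero j
      (Finset.mem_range.2 hj) (Ne.symm h0)
    exact h ⟨k, hk⟩

theorem sum_card_partition_mul_getD_eq_zero {n : ℕ} (hn : n < 500) (hn0 : n ≠ 0) :
    ∑ j ∈ range (n + 1), (Fintype.card (Nat.Partition (n - j)) : ℤ) *
      (1 :: eulerCoeffTail).getD j 0 = 0 := by
  have h := congrArg (PowerSeries.coeff n) mk_card_partition_mul_pentagonalSeries
  rw [PowerSeries.coeff_mul, PowerSeries.coeff_one, if_neg hn0,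
    ← Finset.Nat.sum_antidiagonal_swap, Finset.Nat.sum_antidiagonal_eq_sum_range_succ_mk] at h
  refine (Finset.sum_congr rfl fun j hj => ?_).trans h
  rw [← coeff_pentagonalSeries_eq_getD (by have := Finset.mem_range.1 hj; simp; omega)]
  simp

/-- The list `p (m - 1), …, p 0` of values of the partition function. -/
def reversedPartitions : ℕ → List ℕ
  | 0 => []
  | m + 1 => Fintype.card (Nat.Partition m) :: reversedPartitions m

theorem signedSum_reversedPartitions (m : ℕ) (e : List ℤ) :
    signedSum (reversedPartitions m) e =
      ∑ j ∈ range m, (Fintype.card (Nat.Partition (m - 1 - j)) : ℤ) * e.getD j 0 := by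
  induction m generalizing e with
  | zero => simp [reversedPartitions, signedSum]
  | succ m ih =>
    cases e with
    | nil => simp [signedSum]
    | cons b e =>
      rw [reversedPartitions, signedSum, ih, Finset.sum_range_succ', add_comm]
      simp only [List.getD_cons_succ, List.getD_cons_zero, Nat.add_sub_cancel, Nat.sub_zero]
      congr 1
      refine Finset.sum_congr rfl fun j _ => ?_
      rw [Nat.sub_add_eq, Nat.sub_right_comm]

theorem getD_eq_card_partition {m : ℕ} (hm : m ≠ 0) {r : List ℕ} (hr : m + r.length ≤ 500)
    (h : satisfiesRecurrence eulerCoeffTail (reversedPartitions m) r = true) {i : ℕ}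
    (hi : i < r.length) : r.getD i 0 = Fintype.card (Nat.Partition (m + i)) := by
  induction r generalizing m i with
  | nil => simp at hi
  | cons v r ih =>
    rw [satisfiesRecurrence, Bool.and_eq_true, decide_eq_true_eq] at h
    rw [List.length_cons] at hr hi
    have hv : v = Fintype.card (Nat.Partition m) := by
      have h1 := sum_card_partition_mul_getD_eq_zero (n := m) (by omega) hm
      have h2 := signedSum_reversedPartitions (m + 1) (1 :: eulerCoeffTail)
      rw [Nat.add_sub_cancel, h1, reversedPartitions, signedSum] at h2
      have := h.1
      zify
      linarith
    cases i with
    | zero => simpa using hv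
    | succ i =>
      rw [List.getD_cons_succ, ← add_assoc, add_right_comm]
      refine ih (Nat.succ_ne_zero m) (by omega) ?_ (by omega)
      rw [reversedPartitions, ← hv]
      exact h.2

theorem getD_partitionTail {n : ℕ} (hn : n < 499) :
    partitionTail.getD n 0 = Fintype.card (Nat.Partition (1 + n)) := by
  have hl : partitionTail.length = 499 := by decide +kernel
  refine getD_eq_card_partition one_ne_zero (by rw [hl]) ?_ (by rwa [hl])
  have : reversedPartitions 1 = [1] := by simp [reversedPartitions]
  rw [this]
  exact satisfiesRecurrence_partitionTail

end PartitionTable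

section SmallIndex

/-- The numerator of the Taylor polynomial of degree `k` of `exp` at `U / Q`, over the denominator
`k! * Q ^ k`. -/
def taylorNum (U Q : ℕ) : ℕ → ℕ
  | 0 => 1
  | k + 1 => taylorNum U Q k * ((k + 1) * Q) + U ^ (k + 1)

theorem taylorNum_div (U : ℕ) {Q : ℕ} (hQ : 0 < Q) (k : ℕ) :
    (taylorNum U Q k : ℝ) / (k.factorial * (Q : ℝ) ^ k) =
      ∑ m ∈ range (k + 1), ((U : ℝ) / Q) ^ m / m.factorial := by
  have hQ' : (0 : ℝ) < Q := by exact_mod_cast hQ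
  induction k with
  | zero => simp [taylorNum]
  | succ k ih =>
    have hk : (0 : ℝ) < k.factorial := by exact_mod_cast k.factorial_pos
    rw [Finset.sum_range_succ, ← ih, taylorNum, Nat.factorial_succ]
    push_cast
    rw [div_pow]
    field_simp
    ring

theorem taylorNum_div_le_exp (U : ℕ) {Q : ℕ} (hQ : 0 < Q) {x : ℝ} (hx : (U : ℝ) / Q ≤ x) :
    (taylorNum U Q 12 : ℝ) / ((479001600 * Q ^ 12 : ℕ) : ℝ) ≤ Real.exp x := by
  have h := taylorNum_div U hQ 12
  have h1 := Real.sum_le_exp_of_nonneg (x := (U : ℝ) / Q) (by positivity) 13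
  rw [← h] at h1
  refine le_trans (le_of_eq ?_) (h1.trans (Real.exp_le_exp.2 hx))
  simp [Nat.factorial]

theorem exp_le_taylorNum_div (U : ℕ) {Q : ℕ} (hQ : 0 < Q) (hUQ : U ≤ Q) {x : ℝ}
    (hx : x ≤ (U : ℝ) / Q) :
    Real.exp x ≤ ((taylorNum U Q 12 * (169 * Q) + 14 * U ^ 13 : ℕ) : ℝ) /
      ((80951270400 * Q ^ 13 : ℕ) : ℝ) := by
  have hQ' : (0 : ℝ) < Q := by exact_mod_cast hQ
  have hUQ' : (U : ℝ) ≤ Q := by exact_mod_cast hUQ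
  have h := taylorNum_div U hQ 12
  have h1 := Real.exp_bound' (x := (U : ℝ) / Q) (by positivity) (div_le_one_of_le₀ hUQ' hQ'.le)
    (n := 13) (by norm_num)
  rw [← h] at h1
  refine (Real.exp_le_exp.2 hx).trans (h1.trans (le_of_eq ?_))
  norm_num [Nat.factorial]
  field_simp
  ring

/-- The integer inequality behind the lower bound for `R 4 n`: `P` is the number of partitions of
`n`, `H` approximates `10 ^ 12 * √(24 n)` from below, and `e / d` is an upper bound for
`exp (π √(2 n / 3) / 64)`. -/
def lowerCheck (n P H e d : ℕ) : Bool :=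
  Nat.blt (10000 * n * (24 * n * 10 ^ 12 + 1534269459727) * (H + 1) * e ^ 64)
    (960000 * 1732050807568 * n ^ 3 * P * (H + 1) * d ^ 64 +
      (10000 * n * (24 * n * 2171658704901 + 3260478631878) * 10 ^ 12 +
        3240 * 10 ^ 12 * (H + 1)) * e ^ 64)

/-- The integer inequality behind the upper bound for `R 4 n`, where `e / d` is a lower bound for
`exp (π √(2 n / 3) / 64)`. -/
def upperCheck (n P H e d : ℕ) : Bool :=
  Nat.blt (960000 * 1732050807569 * n ^ 3 * P * H * d ^ 64 +
      10000 * n * (24 * n * 2171658704902 + 3260478631879) * 10 ^ 12 * e ^ 64)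
    ((10000 * n * (24 * n * 10 ^ 12 + 1534269459726) * H + 4080 * 10 ^ 12 * H) * e ^ 64)

/-- All integer inequalities needed to bound `R 4 n`. -/
def remainderCheck (n P H : ℕ) : Bool :=
  Nat.ble (H ^ 2) (24 * n * 10 ^ 24) && Nat.blt (24 * n * 10 ^ 24) ((H + 1) ^ 2) &&
  Nat.ble (314159265358979323847 * (H + 1)) (384 * 10 ^ 32) &&
  lowerCheck n P H
    (taylorNum (314159265358979323847 * (H + 1)) (384 * 10 ^ 32) 12 * (169 * (384 * 10 ^ 32)) +
      14 * (314159265358979323847 * (H + 1)) ^ 13) (80951270400 * (384 * 10 ^ 32) ^ 13) &&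
  upperCheck n P H (taylorNum (314159265358979323846 * H) (384 * 10 ^ 32) 12)
    (479001600 * (384 * 10 ^ 32) ^ 12)

/-- Run `remainderCheck` on consecutive indices starting with `n`. -/
def remainderChecks : ℕ → List ℕ → List ℕ → Bool
  | n, P :: l, H :: r => remainderCheck n P H && remainderChecks (n + 1) l r
  | _, _, _ => true

/-- The values `⌊10 ^ 12 √(24 n)⌋` for `n = 116, …, 499`. -/
def sqrtTable : List ℕ :=
  [
    52763623833091, 52990565197967, 53216538782600, 53441556863549, 53665631459994,
    53888774341229, 54110997033874, 54332310828824, 54552726787943, 54772255750516,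
    54990908339470, 55208694967369, 55425625842204, 55641710972974, 55856960175075,
    56071383075504, 56284989117881, 56497787567302, 56709787515031, 56920997883030,
    57131427428342, 57341084747325, 57549978279752, 57758116312774, 57965506984757,
    58172158288995, 58378078077305, 58583274063507, 58787753826796, 58991524815010,
    59194594347794, 59396969619669, 59598657703005, 59799665550904, 60000000000000,
    60199667773169, 60398675482165, 60597029630172, 60794736614282, 60991802727907,
    61188234163113, 61384037012891, 61579217273362, 61773780845922, 61967733539318,
    62161081071680, 62353829072479, 62545983084447, 62737548565432, 62928530890209,
    63118935352238, 63308767165377, 63498031465550, 63686733312362, 63874877690685,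
    64062469512187, 64249513616836, 64436014774348, 64621977685614, 64807406984078,
    64992307237087, 65176682947201, 65360538553472, 65543878432695, 65726706900619,
    65909028213136, 66090846567433, 66272166103123, 66452990903344, 66633324995830,
    66813172353960, 66992536897776, 67171422494986, 67349832961930, 67527772064536,
    67705243519243, 67882250993908, 68058798108694, 68234888436927, 68410525505948,
    68585712797928, 68760453750684, 68934751758456, 69108610172683, 69282032302755,
    69455021416741, 69627580742116, 69799713466460, 69971422738143, 70142711667000,
    70313583324987, 70484040746824, 70654086930622, 70823724838503, 70992957397195,
    71161787498628, 71330218000508, 71498251726877, 71665891468675, 71833139984271,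
    72000000000000, 72166474210674, 72332565280100, 72498275841567, 72663608498339,
    72828565824132, 72993150363578, 73157364632687, 73321211119293, 73484692283495,
    73647810558087, 73810568348983, 73972968035627, 74135011971402, 74296702484026,
    74458041875945, 74619032424710, 74779676383359, 74939975980780, 75099933422074,
    75259550888907, 75418830539859, 75577774510764, 75736384915045, 75894663844041,
    76052613367326, 76210235533030, 76367532368147, 76524505878835, 76681158050723,
    76837490849194, 76993506219680, 77149206087943, 77304592360350, 77459666924148,
    77614431647729, 77768888380894, 77923038955112, 78076885183772, 78230428862431,
    78383671769061, 78536615664287, 78689262291624, 78841613377708, 78993670632525,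
    79145435749637, 79296910406396, 79448096264164, 79598994968529, 79749608149507,
    79899937421752, 80049984384758, 80199750623053, 80349237706402, 80498447189992,
    80647380614623, 80796039506896, 80944425379392, 81092539730853, 81240384046359,
    81387959797503, 81535268442558, 81682311426648, 81829090181915, 81975606127676,
    82121860670591, 82267855204812, 82413591112146, 82559069762201, 82704292512541,
    82849260708831, 82993975684985, 83138438763306, 83282651254628, 83426614458456,
    83570329663104, 83713798145825, 83857021172946, 84000000000000, 84142735871850,
    84285230022821, 84427483676821, 84569498047463, 84711274338189, 84852813742385,
    84994117443503, 85135186615171, 85276022421311, 85416626016250, 85556998544829,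
    85697141142514, 85837054935499, 85976741040818, 86116200566443, 86255434611391,
    86394444265820, 86533230611135, 86671794720081, 86810137656842, 86948260477136,
    87086164228308, 87223849949426, 87361318671366, 87498571416909, 87635609200826,
    87772433029966, 87909043903343, 88045442812220, 88181630740194, 88317608663278,
    88453377549983, 88588938361400, 88724292051275, 88859439566092, 88994381845147,
    89129119820628, 89263654417685, 89397986554508, 89532117142397, 89666047085839,
    89799777282574, 89933308623668, 90066641993581, 90199778270237, 90332718325089,
    90465463023189, 90598013223248, 90730369777710, 90862533532804, 90994505328618,
    91126285999156, 91257876372398, 91389277270366, 91520489509180, 91651513899116,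
    91782351244670, 91913002344608, 92043467992030, 92173748974423, 92303846073714,
    92433760066330, 92563491723249, 92693041810051, 92822411086978, 92951600308978,
    93080610225760, 93209441581848, 93338095116624, 93466571564383, 93594871654380,
    93722996110879, 93850945653200, 93978720995765, 94106322848148, 94233751915117,
    94361008896683, 94488094488141, 94615009380118, 94741754258616, 94868329805051,
    94994736696303, 95120975604752, 95247047198325, 95372952140530, 95498691090506,
    95624264703055, 95749673628686, 95874918513655, 96000000000000, 96124918725583,
    96249675324127, 96374270425254, 96498704654518, 96622978633449, 96747092979582,
    96871048306498, 96994845223857, 97118484337431, 97241966249145, 97365291557104,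
    97488460855631, 97611474735299, 97734333782964, 97857038581800, 97979589711327,
    98101987747445, 98224233262469, 98346326825153, 98468269000729, 98590060350929,
    98711701434024, 98833192804846, 98954535014823, 99075728612006, 99196774141097,
    99317672143481, 99438423157248, 99559027717229, 99679486355016, 99799799598997,
    99919967974374, 100039992003198, 100159872204391, 100279609093773, 100399203184089,
    100518654985032, 100637965003272, 100757133742479, 100876161703347, 100995049383620,
    101113797278116, 101232405878750, 101350875674559, 101469207151726, 101587400793602,
    101705457080728, 101823376490862, 101941159498997, 102058806577384, 102176318195558,
    102293694820355, 102410936915936, 102528044943810, 102645019362850, 102761860629321,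
    102878569196893, 102995145516669, 103111590037201, 103227903204511, 103344085462110,
    103460137251020, 103576059009792, 103691851174525, 103807514178887, 103923048454132,
    104038454429119, 104153732530332, 104268883181896, 104383906805599, 104498803820905,
    104613574644976, 104728219692688, 104842739376649, 104957134107215, 105071404292509,
    105185550338437, 105299572648705, 105413471624835, 105527247666183, 105640901169954,
    105754432531218, 105867842142928, 105981130395934, 106094297678998, 106207344378814,
    106320270880016, 106433077565200, 106545764814937, 106658333007787, 106770782520313,
    106883113727099, 106995327000762, 107107422711967, 107219401229441, 107331262919989,
    107443008148506, 107554637277990, 107666150669558, 107777548682459, 107888831674089,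
    108000000000000, 108111054013916, 108221994067749, 108332820511606, 108443533693807,
    108554133960895, 108664621657648, 108774997127097, 108885260710529, 108995412747509,
    109105453575886, 109215383531808, 109325202949731, 109434912162435]

theorem remainderChecks_partitionTail :
    remainderChecks 116 (partitionTail.drop 115) sqrtTable = true := by
  decide +kernel

end SmallIndex

section SmallIndexBound

theorem remainderCheck_of_remainderChecks {n : ℕ} {l r : List ℕ}
    (h : remainderChecks n l r = true) {i : ℕ} (hl : i < l.length) (hr : i < r.length) :
    remainderCheck (n + i) (l.getD i 0) (r.getD i 0) = true := by
  induction l generalizing n r i with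
  | nil => simp at hl
  | cons P l ih =>
    cases r with
    | nil => simp at hr
    | cons H r =>
      rw [remainderChecks, Bool.and_eq_true] at h
      rw [List.length_cons] at hl hr
      cases i with
      | zero => exact h.1
      | succ i =>
        rw [List.getD_cons_succ, List.getD_cons_succ, ← add_assoc, add_right_comm]
        exact ih h.2 (by omega) (by omega)

theorem exists_remainderCheck {n : ℕ} (h1 : 116 ≤ n) (h2 : n < 500) :
    ∃ H, remainderCheck n (Fintype.card (Nat.Partition n)) H = true := by
  have hl : (partitionTail.drop 115).length = 384 := by decide +kernel
  have hr : sqrtTable.length = 384 := by decide +kernel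
  have h := remainderCheck_of_remainderChecks remainderChecks_partitionTail (i := n - 116)
    (by omega) (by omega)
  have hP : (partitionTail.drop 115).getD (n - 116) 0 = Fintype.card (Nat.Partition n) := by
    rw [List.getD_eq_getElem?_getD, List.getElem?_drop, ← List.getD_eq_getElem?_getD,
      getD_partitionTail (by omega), show 1 + (115 + (n - 116)) = n by omega]
  rw [hP, Nat.add_sub_cancel' h1] at h
  exact ⟨_, h⟩

theorem linear_coeff_bounds : 2.171658704901 ≤ π / 6 / 2 + 6 / π ∧
    π / 6 / 2 + 6 / π ≤ 2.171658704902 := by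
  have h1 := Real.pi_gt_d20
  have h2 := Real.pi_lt_d20
  have h3 : 1.9098593171027 ≤ 6 / π := (le_div_iff₀ Real.pi_pos).2 (by linarith)
  have h4 : 6 / π ≤ 1.9098593171028 := (div_le_iff₀ Real.pi_pos).2 (by linarith)
  constructor <;> linarith

theorem quadratic_coeff_bounds : 1.534269459726 ≤ (π / 6) ^ 2 / 8 + 3 / 2 ∧
    (π / 6) ^ 2 / 8 + 3 / 2 ≤ 1.534269459727 := by
  have h1 := Real.pi_gt_d20
  have h2 := Real.pi_lt_d20
  have h3 := pow_le_pow_left₀ (by norm_num) h1.le 2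
  have h4 := pow_le_pow_left₀ Real.pi_pos.le h2.le 2
  constructor <;> linarith

theorem cubic_coeff_bounds : 3.260478631878 ≤ (π / 6) ^ 3 / 48 + 3 * (π / 6) / 4 + 3 * (6 / π) / 2 ∧
    (π / 6) ^ 3 / 48 + 3 * (π / 6) / 4 + 3 * (6 / π) / 2 ≤ 3.260478631879 := by
  have h1 := Real.pi_gt_d20
  have h2 := Real.pi_lt_d20
  have h3 : 1.9098593171027 ≤ 6 / π := (le_div_iff₀ Real.pi_pos).2 (by linarith)
  have h4 : 6 / π ≤ 1.9098593171028 := (div_le_iff₀ Real.pi_pos).2 (by linarith)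
  have h5 := pow_le_pow_left₀ (by norm_num) h1.le 3
  have h6 := pow_le_pow_left₀ Real.pi_pos.le h2.le 3
  constructor <;> linarith

theorem lt_of_lowerCheck {n P H e d : ℕ} (hn : 0 < n) (hd : 0 < d)
    (h : lowerCheck n P H e d = true) :
    (1 + 1.534269459727 / (24 * n) - (2.171658704901 + 3.260478631878 / (24 * n)) /
      (((H : ℝ) + 1) / 10 ^ 12) - 0.0135 / (n : ℝ) ^ 2) * ((e : ℝ) / d) ^ 64 <
        4 * 1.732050807568 * n * P := by
  have hn' : (0 : ℝ) < n := by exact_mod_cast hn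
  have hd' : (0 : ℝ) < d := by exact_mod_cast hd
  rw [lowerCheck, Nat.blt_eq] at h
  replace h := (Nat.cast_lt (α := ℝ)).2 h
  push_cast at h
  have hH : (0 : ℝ) < H + 1 := by positivity
  rw [div_pow]
  generalize (e : ℝ) ^ 64 = E at *
  have hD : (0 : ℝ) < (d : ℝ) ^ 64 := by positivity
  generalize (d : ℝ) ^ 64 = D at *
  generalize (H : ℝ) + 1 = G at *
  have hK : (0 : ℝ) < 240000 * n ^ 2 * 10 ^ 12 * G * D := by positivity
  refine lt_of_mul_lt_mul_left ?_ hK.le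
  have e1 : 240000 * (n : ℝ) ^ 2 * 10 ^ 12 * G * D * ((1 + 1.534269459727 / (24 * n) -
      (2.171658704901 + 3.260478631878 / (24 * n)) / (G / 10 ^ 12) - 0.0135 / (n : ℝ) ^ 2) *
        (E / D)) = 10000 * n * (24 * n * 10 ^ 12 + 1534269459727) * G * E -
          (10000 * n * (24 * n * 2171658704901 + 3260478631878) * 10 ^ 12 +
            3240 * 10 ^ 12 * G) * E := by
    field_simp
    ring
  rw [e1]
  linarith

theorem lt_of_upperCheck {n P H e d : ℕ} (hn : 0 < n) (hH : 0 < H) (hd : 0 < d)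
    (h : upperCheck n P H e d = true) :
    4 * 1.732050807569 * n * P <
      (1 + 1.534269459726 / (24 * n) - (2.171658704902 + 3.260478631879 / (24 * n)) /
        ((H : ℝ) / 10 ^ 12) + 0.017 / (n : ℝ) ^ 2) * ((e : ℝ) / d) ^ 64 := by
  have hn' : (0 : ℝ) < n := by exact_mod_cast hn
  have hd' : (0 : ℝ) < d := by exact_mod_cast hd
  have hH' : (0 : ℝ) < H := by exact_mod_cast hH
  rw [upperCheck, Nat.blt_eq] at h
  replace h := (Nat.cast_lt (α := ℝ)).2 h
  push_cast at h
  rw [div_pow]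
  generalize (e : ℝ) ^ 64 = E at *
  have hD : (0 : ℝ) < (d : ℝ) ^ 64 := by positivity
  generalize (d : ℝ) ^ 64 = D at *
  generalize (H : ℝ) = G at *
  have hK : (0 : ℝ) < 240000 * n ^ 2 * 10 ^ 12 * G * D := by positivity
  refine lt_of_mul_lt_mul_left ?_ hK.le
  have e1 : 240000 * (n : ℝ) ^ 2 * 10 ^ 12 * G * D * ((1 + 1.534269459726 / (24 * n) -
      (2.171658704902 + 3.260478631879 / (24 * n)) / (G / 10 ^ 12) + 0.017 / (n : ℝ) ^ 2) *
        (E / D)) = (10000 * n * (24 * n * 10 ^ 12 + 1534269459726) * G + 4080 * 10 ^ 12 * G) * E -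
          10000 * n * (24 * n * 2171658704902 + 3260478631879) * 10 ^ 12 * E := by
    field_simp
    ring
  rw [e1]
  linarith

theorem R_four_bounds_of_remainderCheck {n H : ℕ} (hn : 0 < n)
    (h : remainderCheck n (Fintype.card (Nat.Partition n)) H = true) :
    -(0.0135 / (n : ℝ) ^ 2) < R 4 n ∧ R 4 n < 0.017 / (n : ℝ) ^ 2 := by
  have hn' : (0 : ℝ) < n := by exact_mod_cast hn
  simp only [remainderCheck, Bool.and_eq_true, Nat.ble_eq, Nat.blt_eq] at h
  obtain ⟨⟨⟨⟨hH0, hH1⟩, hQ⟩, hlow⟩, hup⟩ := h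
  have hHpos : 0 < H := by
    by_contra h0
    obtain rfl : H = 0 := by omega
    omega
  have hHpos' : (0 : ℝ) < H := by exact_mod_cast hHpos
  have hQ0 : 0 < 384 * 10 ^ 32 := by norm_num
  obtain ⟨e, d, hd, hl, hE⟩ : ∃ e d : ℕ, 0 < d ∧
      lowerCheck n (Fintype.card (Nat.Partition n)) H e d = true ∧ ∀ x : ℝ,
        x ≤ ((314159265358979323847 * (H + 1) : ℕ) : ℝ) / ((384 * 10 ^ 32 : ℕ) : ℝ) →
          Real.exp x ≤ (e : ℝ) / d :=
    ⟨_, _, by positivity, hlow, fun x => exp_le_taylorNum_div _ hQ0 hQ⟩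
  obtain ⟨e', d', hd', hu, hE'⟩ : ∃ e d : ℕ, 0 < d ∧
      upperCheck n (Fintype.card (Nat.Partition n)) H e d = true ∧ ∀ x : ℝ,
        ((314159265358979323846 * H : ℕ) : ℝ) / ((384 * 10 ^ 32 : ℕ) : ℝ) ≤ x →
          (e : ℝ) / d ≤ Real.exp x :=
    ⟨_, _, by positivity, hup, fun x => taylorNum_div_le_exp _ hQ0⟩
  replace hl := lt_of_lowerCheck hn hd hl
  replace hu := lt_of_upperCheck hn hHpos hd' hu
  clear hlow hup
  have hs0 : 0 < √(24 * n : ℝ) := Real.sqrt_pos.2 (by positivity)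
  have hs2 : √(24 * n : ℝ) ^ 2 = 24 * n := Real.sq_sqrt (by positivity)
  have hx : π * √(2 * n / 3) = 64 * (π * √(24 * n) / 384) := by
    rw [show (24 : ℝ) * n = 6 ^ 2 * (2 * n / 3) by ring, Real.sqrt_mul (by norm_num),
      Real.sqrt_sq (by norm_num)]
    ring
  have hR : R 4 n = 4 * √3 * n * Fintype.card (Nat.Partition n) /
      Real.exp (π * √(24 * n) / 384) ^ 64 -
      (1 - (π / 6 / 2 + 6 / π) * (1 / √(24 * n)) + ((π / 6) ^ 2 / 8 + 3 / 2) *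
        (1 / √(24 * n)) ^ 2 - ((π / 6) ^ 3 / 48 + 3 * (π / 6) / 4 + 3 * (6 / π) / 2) *
          (1 / √(24 * n)) ^ 3) := by
    rw [R, sum_c_div_rpow_eq hn, p, hx, Real.exp_neg, ← Real.exp_nat_mul]
    push_cast
    ring
  obtain ⟨a1, a2⟩ := linear_coeff_bounds
  obtain ⟨b1, b2⟩ := quadratic_coeff_bounds
  obtain ⟨d1, d2⟩ := cubic_coeff_bounds
  generalize π / 6 / 2 + 6 / π = A at *
  generalize (π / 6) ^ 2 / 8 + 3 / 2 = B at *
  generalize (π / 6) ^ 3 / 48 + 3 * (π / 6) / 4 + 3 * (6 / π) / 2 = D at *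
  have h3l : 1.732050807568 ≤ √(3 : ℝ) := Real.le_sqrt_of_sq_le (by norm_num)
  have h3u : √(3 : ℝ) ≤ 1.732050807569 := Real.sqrt_le_iff.2 (by norm_num)
  have hpi1 := Real.pi_gt_d20
  have hpi2 := Real.pi_lt_d20
  set s := √(24 * n : ℝ) with hs
  have hsl : (H : ℝ) / 10 ^ 12 ≤ s := by
    rw [hs]
    refine Real.le_sqrt_of_sq_le ?_
    have : (H : ℝ) ^ 2 ≤ 24 * n * 10 ^ 24 := by exact_mod_cast hH0
    rw [div_pow, div_le_iff₀ (by norm_num)]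
    linarith
  have hsu : s ≤ ((H : ℝ) + 1) / 10 ^ 12 := by
    rw [hs]
    refine Real.sqrt_le_iff.2 ⟨by positivity, ?_⟩
    have : 24 * (n : ℝ) * 10 ^ 24 < (H + 1) ^ 2 := by exact_mod_cast hH1
    rw [div_pow, le_div_iff₀ (by norm_num)]
    linarith
  have hXu := pow_le_pow_left₀ (Real.exp_pos _).le (hE (π * s / 384) (by
    have : π * s ≤ 3.14159265358979323847 * (((H : ℝ) + 1) / 10 ^ 12) := by gcongr
    push_cast
    linarith)) 64
  have hXl := pow_le_pow_left₀ (by positivity) (hE' (π * s / 384) (by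
    have : 3.14159265358979323846 * ((H : ℝ) / 10 ^ 12) ≤ π * s := by gcongr
    push_cast
    linarith)) 64
  have hX : 0 < Real.exp (π * s / 384) ^ 64 := by positivity
  generalize Real.exp (π * s / 384) ^ 64 = X at *
  have hS : 1 - A * (1 / s) + B * (1 / s) ^ 2 - D * (1 / s) ^ 3 =
      1 + B / (24 * n) - (A + D / (24 * n)) / s := by
    rw [← hs2]
    field_simp
    ring
  rw [hR, hS]
  have hP : (0 : ℝ) ≤ Fintype.card (Nat.Partition n) := by positivity
  have hSu : 1 + B / (24 * n) - (A + D / (24 * n)) / s ≤ 1 + 1.534269459727 / (24 * n) -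
      (2.171658704901 + 3.260478631878 / (24 * n)) / (((H : ℝ) + 1) / 10 ^ 12) := by
    gcongr
  have hSl : 1 + 1.534269459726 / (24 * n) -
      (2.171658704902 + 3.260478631879 / (24 * n)) / ((H : ℝ) / 10 ^ 12) ≤
        1 + B / (24 * n) - (A + D / (24 * n)) / s := by
    gcongr
  generalize 1 + B / (24 * n) - (A + D / (24 * n)) / s = S at *
  generalize (1 : ℝ) + 1.534269459727 / (24 * n) -
      (2.171658704901 + 3.260478631878 / (24 * n)) / (((H : ℝ) + 1) / 10 ^ 12) = Su at *
  generalize (1 : ℝ) + 1.534269459726 / (24 * n) -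
      (2.171658704902 + 3.260478631879 / (24 * n)) / ((H : ℝ) / 10 ^ 12) = Sl at *
  generalize ((Fintype.card (Nat.Partition n) : ℕ) : ℝ) = P at *
  constructor
  · have hM : 4 * 1.732050807568 * n * P ≤ 4 * √3 * n * P := by gcongr
    have hM0 : 0 ≤ 4 * 1.732050807568 * n * P := by positivity
    rw [lt_sub_iff_add_lt, lt_div_iff₀ hX]
    have h1 : (-(0.0135 / (n : ℝ) ^ 2) + S) * X ≤ (Su - 0.0135 / (n : ℝ) ^ 2) * X := by
      gcongr
      linarith
    rcases le_or_gt 0 (Su - 0.0135 / (n : ℝ) ^ 2) with h0 | h0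
    · have := mul_le_mul_of_nonneg_left hXu h0
      linarith
    · linarith [mul_neg_of_neg_of_pos h0 hX]
  · have hM : 4 * √3 * n * P ≤ 4 * 1.732050807569 * n * P := by gcongr
    have hM0 : 0 ≤ 4 * 1.732050807569 * n * P := by positivity
    rw [sub_lt_iff_lt_add, div_lt_iff₀ hX]
    have hY : (0 : ℝ) ≤ ((e' : ℝ) / d') ^ 64 :=
      pow_nonneg (div_nonneg e'.cast_nonneg d'.cast_nonneg) 64
    have h0 : 0 ≤ Sl + 0.017 / (n : ℝ) ^ 2 := by
      by_contra! hneg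
      have := mul_nonpos_of_nonpos_of_nonneg hneg.le hY
      linarith
    have := mul_le_mul_of_nonneg_left hXl h0
    have h1 : (Sl + 0.017 / (n : ℝ) ^ 2) * X ≤ (S + 0.017 / (n : ℝ) ^ 2) * X := by
      gcongr
    linarith

end SmallIndexBound

theorem stmt15 (n : ℕ) (hn : 116 ≤ n) :
    -(0.0135 / (n : ℝ) ^ 2) < R 4 n ∧ R 4 n < 0.017 / (n : ℝ) ^ 2 := by
  rcases lt_or_ge n 500 with h | h
  · obtain ⟨H, hH⟩ := exists_remainderCheck hn h
    exact R_four_bounds_of_remainderCheck (by omega) hH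
  · have hn' : (0 : ℝ) < n := by exact_mod_cast (by omega : 0 < n)
    obtain ⟨h1, h2⟩ := abs_le.1 (abs_R_four_le_of_le h)
    constructor
    · refine lt_of_lt_of_le (neg_lt_neg ?_) h1
      gcongr
      norm_num
    · refine lt_of_le_of_lt h2 ?_
      gcongr
      norm_num
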